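/- arXiv:2106.04002 — 2 statements merged into one kernel-verified Lean document; each statement's English description precedes it below -/
import Mathlib

section
/- Let 2 < p < ∞, let ρ ⊆ [0,1) have 1 as a limit point, and let K ⊆ 𝕋 be compact such that either m(K) > 0 and K contains no compact subset of positive arc length measure satisfying Carleson's condition, or m(K) = 0. Then the set 𝒟𝒱_{A^p}^K(𝔻,ρ) is a dense G_δ subset of the Banach space A^p(𝔻). -/
open Complex Metric Set Filter MeasureTheory Polynomial Topology

noncomputable section

/-- The Hardy `p`-norm of a function `f` on the unit disk:
`sup_{0<r<1} ((1/2π) ∫_0^{2π} |f(r e^{iθ})|^p dθ)^{1/p}`. -/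
def hardyNorm (p : ℝ) (f : ℂ → ℂ) : ℝ :=
  ⨆ r : Set.Ioo (0:ℝ) 1,
    ((1 / (2 * Real.pi)) *
      ∫ θ in (0:ℝ)..(2 * Real.pi),
        ‖f (((r : ℝ) : ℂ) * Complex.exp ((θ : ℂ) * Complex.I))‖ ^ p) ^ (1 / p)

/-- Membership in the Hardy space `H^p(𝔻)`: `f` is holomorphic on the unit disk and the
means `((1/2π) ∫_0^{2π} |f(r e^{iθ})|^p dθ)^{1/p}` are uniformly bounded for `0 < r < 1`. -/
def MemHp (p : ℝ) (f : ℂ → ℂ) : Prop :=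
  DifferentiableOn ℂ f (Metric.ball (0:ℂ) 1) ∧
  BddAbove (Set.range fun r : Set.Ioo (0:ℝ) 1 =>
    ((1 / (2 * Real.pi)) *
      ∫ θ in (0:ℝ)..(2 * Real.pi),
        ‖f (((r : ℝ) : ℂ) * Complex.exp ((θ : ℂ) * Complex.I))‖ ^ p) ^ (1 / p))

/-- The Hardy space `H^p(𝔻)` as a type. -/
def HpSpace (p : ℝ) := {f : ℂ → ℂ // MemHp p f}

/-- The norm topology on `H^p(𝔻)`, generated by the open balls of the Hardy norm. -/
instance hpTopology (p : ℝ) : TopologicalSpace (HpSpace p) :=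
  TopologicalSpace.generateFrom
    {U : Set (HpSpace p) | ∃ (f : HpSpace p) (ε : ℝ), 0 < ε ∧
      U = {g : HpSpace p | hardyNorm p (fun z => g.1 z - f.1 z) < ε}}

/-- The arc length measure of a subset `K` of the unit circle `𝕋 ⊆ ℂ`, computed as the
Lebesgue measure of the set of angles `θ ∈ [0, 2π)` with `e^{iθ} ∈ K`. -/
def arcMeasure (K : Set ℂ) : ENNReal :=
  MeasureTheory.volume {θ : ℝ | θ ∈ Set.Ico (0:ℝ) (2 * Real.pi) ∧
    Complex.exp ((θ : ℂ) * Complex.I) ∈ K}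

/-- The Bergman `p`-norm of `f` on the unit disk, with respect to normalised area measure. -/
def bergmanNorm (p : ℝ) (f : ℂ → ℂ) : ℝ :=
  ((Real.pi)⁻¹ * ∫ z in Metric.ball (0:ℂ) 1, ‖f z‖ ^ p) ^ (1 / p)

/-- Membership in the Bergman space `A^p(𝔻)`: `f` is holomorphic on the unit disk and
`|f|^p` is integrable there. -/
def MemAp (p : ℝ) (f : ℂ → ℂ) : Prop :=
  DifferentiableOn ℂ f (Metric.ball (0:ℂ) 1) ∧
  MeasureTheory.IntegrableOn (fun z => ‖f z‖ ^ p) (Metric.ball (0:ℂ) 1)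

/-- The Bergman space `A^p(𝔻)` as a type. -/
def ApSpace (p : ℝ) := {f : ℂ → ℂ // MemAp p f}

/-- The norm topology on `A^p(𝔻)`, generated by the open balls of the Bergman norm. -/
instance apTopology (p : ℝ) : TopologicalSpace (ApSpace p) :=
  TopologicalSpace.generateFrom
    {U : Set (ApSpace p) | ∃ (f : ApSpace p) (ε : ℝ), 0 < ε ∧
      U = {g : ApSpace p | bergmanNorm p (fun z => g.1 z - f.1 z) < ε}}

/-- A subset of the unit circle is an open subarc if it is the image under `θ ↦ e^{iθ}` of a
nonempty open interval of length at most `2π`. -/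
def IsOpenArc (B : Set ℂ) : Prop :=
  ∃ a b : ℝ, a < b ∧ b ≤ a + 2 * Real.pi ∧
    B = (fun θ : ℝ => Complex.exp ((θ : ℂ) * Complex.I)) '' Set.Ioo a b

/-- A compact subset `E` of the unit circle (of positive arc length) satisfies Carleson's
condition if, writing `𝕋 \ E` as a disjoint union of open subarcs `B k`, one has
`Σ_k m(B_k) log(1/m(B_k)) < ∞`. -/
def SatisfiesCarleson (E : Set ℂ) : Prop :=
  ∃ B : ℕ → Set ℂ, (∀ k, IsOpenArc (B k) ∨ B k = ∅) ∧
    Pairwise (Function.onFun Disjoint B) ∧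
    Metric.sphere (0:ℂ) 1 \ E = ⋃ k, B k ∧
    Summable (fun k =>
      (arcMeasure (B k)).toReal * Real.log (1 / (arcMeasure (B k)).toReal))

/-- The admissibility condition on `K ⊆ 𝕋` for the Bergman space results: either `m(K) > 0`
and `K` contains no compact subset of positive arc length satisfying Carleson's condition, or
`m(K) = 0`. -/
def BergmanAdmissible (K : Set ℂ) : Prop :=
  (arcMeasure K ≠ 0 ∧
    ∀ E : Set ℂ, E ⊆ K → IsCompact E → arcMeasure E ≠ 0 → ¬ SatisfiesCarleson E) ∨
  arcMeasure K = 0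

/-- The class `𝒟𝒱_{A^p}^K(𝔻,ρ)` of functions in `A^p(𝔻)` all of whose derivatives have
universal radial limits on `K` along dilation parameters from `ρ`. -/
def DVAp (p : ℝ) (ρ : Set ℝ) (K : Set ℂ) : Set (ApSpace p) :=
  {f : ApSpace p | ∀ φ : ℂ → ℂ, ContinuousOn φ K →
    ∀ L : Set ℂ, IsCompact L → L ⊆ Metric.ball (0:ℂ) 1 → ∀ l : ℕ,
      ∃ r : ℕ → ℝ, (∀ n, r n ∈ ρ) ∧ StrictMono r ∧
        Filter.Tendsto r Filter.atTop (nhds 1) ∧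
        Filter.Tendsto
          (fun n => ⨆ ζ ∈ K, ⨆ z ∈ L,
            ‖iteratedDeriv l f.1 (((r n : ℝ) : ℂ) * (ζ - z) + z) - φ ζ‖)
          Filter.atTop (nhds 0)}

/-- The half-open dyadic interval `[k / 2 ^ n, (k + 1) / 2 ^ n)`. -/
def dyadicIco (n k : ℕ) : Set ℝ := Ico ((k : ℝ) / 2 ^ n) (((k : ℝ) + 1) / 2 ^ n)

lemma measurableSet_dyadicIco (n k : ℕ) : MeasurableSet (dyadicIco n k) := measurableSet_Ico

lemma mem_dyadicIco {n k : ℕ} {t : ℝ} :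
    t ∈ dyadicIco n k ↔ (k : ℝ) ≤ t * 2 ^ n ∧ t * 2 ^ n < k + 1 := by
  simp only [dyadicIco, mem_Ico]
  rw [div_le_iff₀ (by positivity), lt_div_iff₀ (by positivity)]

lemma dyadicIco_eq_of_mem {n k k' : ℕ} {t : ℝ} (h : t ∈ dyadicIco n k)
    (h' : t ∈ dyadicIco n k') : k = k' := by
  rw [mem_dyadicIco] at h h'
  have h1 : (k : ℝ) < k' + 1 := h.1.trans_lt h'.2
  have h2 : (k' : ℝ) < k + 1 := h'.1.trans_lt h.2
  norm_cast at h1 h2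
  omega

lemma dyadicIco_disjoint {n k k' : ℕ} (h : k ≠ k') :
    Disjoint (dyadicIco n k) (dyadicIco n k') :=
  Set.disjoint_left.2 fun _ h1 h2 => h (dyadicIco_eq_of_mem h1 h2)

lemma dyadicIco_split (n k : ℕ) :
    dyadicIco n k = dyadicIco (n + 1) (2 * k) ∪ dyadicIco (n + 1) (2 * k + 1) := by
  ext t
  simp only [mem_union, mem_dyadicIco, pow_succ]
  push_cast
  constructor
  · rintro ⟨h1, h2⟩
    by_cases h : t * (2 ^ n * 2) < 2 * k + 1
    · left; constructor <;> linarith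
    · right; constructor <;> linarith
  · rintro (⟨h1, h2⟩ | ⟨h1, h2⟩) <;> constructor <;> linarith

lemma dyadicIco_children_disjoint (n k : ℕ) :
    Disjoint (dyadicIco (n + 1) (2 * k)) (dyadicIco (n + 1) (2 * k + 1)) :=
  dyadicIco_disjoint (by omega)

lemma volume_dyadicIco (n k : ℕ) : volume (dyadicIco n k) = ENNReal.ofReal (1 / 2 ^ n) := by
  rw [dyadicIco, Real.volume_Ico]
  congr 1
  ring

lemma exists_mem_dyadicIco (n : ℕ) {t : ℝ} (ht : 0 ≤ t) : ∃ k, t ∈ dyadicIco n k :=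
  ⟨⌊t * 2 ^ n⌋₊, mem_dyadicIco.2 ⟨Nat.floor_le (by positivity), Nat.lt_floor_add_one _⟩⟩

/-- If two dyadic intervals meet, the one of the finer generation lies in the other one. -/
lemma dyadicIco_subset_of_mem {n m k l : ℕ} (hnm : n ≤ m) {t : ℝ} (h : t ∈ dyadicIco n k)
    (h' : t ∈ dyadicIco m l) : dyadicIco m l ⊆ dyadicIco n k := by
  induction m, hnm using Nat.le_induction generalizing l with
  | base => rw [dyadicIco_eq_of_mem h h']
  | succ m hm ih =>
    have key : dyadicIco (m + 1) l ⊆ dyadicIco m (l / 2) := by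
      rcases Nat.even_or_odd' l with ⟨c, rfl | rfl⟩
      · rw [Nat.mul_div_cancel_left _ two_pos, dyadicIco_split m c]; exact subset_union_left
      · rw [show (2 * c + 1) / 2 = c by omega, dyadicIco_split m c]; exact subset_union_right
    exact key.trans (ih (key h'))

/-- The closed dyadic interval with index `(n, k)` does not meet `T`. -/
def DyadicFree (T : Set ℝ) (n k : ℕ) : Prop :=
  Disjoint (Icc ((k : ℝ) / 2 ^ n) (((k : ℝ) + 1) / 2 ^ n)) T

lemma DyadicFree.of_subset {T : Set ℝ} {n k m l : ℕ} (h : DyadicFree T n k)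
    (hs : dyadicIco m l ⊆ dyadicIco n k) : DyadicFree T m l := by
  have hc : ∀ n k : ℕ, closure (dyadicIco n k) = Icc ((k : ℝ) / 2 ^ n) (((k : ℝ) + 1) / 2 ^ n) := by
    intro n k
    rw [dyadicIco, closure_Ico]
    exact (div_lt_div_of_pos_right (lt_add_one _) (by positivity)).ne
  unfold DyadicFree at h ⊢
  rw [← hc] at h ⊢
  exact h.mono_left (closure_mono hs)

lemma DyadicFree.left {T : Set ℝ} {n k : ℕ} (h : DyadicFree T n k) :
    DyadicFree T (n + 1) (2 * k) :=
  h.of_subset (by rw [dyadicIco_split n k]; exact subset_union_left)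

lemma DyadicFree.right {T : Set ℝ} {n k : ℕ} (h : DyadicFree T n k) :
    DyadicFree T (n + 1) (2 * k + 1) :=
  h.of_subset (by rw [dyadicIco_split n k]; exact subset_union_right)

/-- A point outside the closed set `T` lies in a free dyadic interval of every large
generation. -/
lemma exists_dyadicFree {T : Set ℝ} (hT : IsClosed T) {t : ℝ} (ht : 0 ≤ t) (htT : t ∉ T)
    (n : ℕ) : ∃ m k, n ≤ m ∧ t ∈ dyadicIco m k ∧ DyadicFree T m k := by
  obtain ⟨ε, hε, hb⟩ := Metric.isOpen_iff.1 hT.isOpen_compl t htT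
  obtain ⟨m₀, hm₀⟩ := exists_pow_lt_of_lt_one hε (show (1 / 2 : ℝ) < 1 by norm_num)
  obtain ⟨k, hk⟩ := exists_mem_dyadicIco (max n m₀) ht
  refine ⟨max n m₀, k, le_max_left _ _, hk, ?_⟩
  rw [DyadicFree, Set.disjoint_left]
  intro x hx
  apply hb
  have h1 : (1 : ℝ) / 2 ^ max n m₀ < ε := by
    refine lt_of_le_of_lt ?_ hm₀
    rw [one_div_pow]
    exact one_div_le_one_div_of_le (by positivity)
      (pow_le_pow_right₀ one_le_two (le_max_right _ _))
  rw [dyadicIco] at hk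
  have h2 : ((k : ℝ) + 1) / 2 ^ max n m₀ = k / 2 ^ max n m₀ + 1 / 2 ^ max n m₀ := by ring
  rw [mem_ball, Real.dist_eq, abs_lt]
  constructor <;> linarith [hx.1, hx.2, hk.1, hk.2]

open scoped Classical in
/-- The largest mass that can be put on the free intervals of generation `n + j` below the dyadic
interval `(n, k)` such that no interval of generation `i` carries more than `i / 2 ^ i`. -/
def dyadicFlow (T : Set ℝ) : ℕ → ℕ → ℕ → ℝ
  | 0, n, k => if DyadicFree T n k then n / 2 ^ n else 0
  | j + 1, n, k => min (n / 2 ^ n)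
      (dyadicFlow T j (n + 1) (2 * k) + dyadicFlow T j (n + 1) (2 * k + 1))

lemma dyadicFlow_nonneg (T : Set ℝ) (j n k : ℕ) : 0 ≤ dyadicFlow T j n k := by
  induction j generalizing n k with
  | zero => rw [dyadicFlow]; split_ifs <;> positivity
  | succ j ih => exact le_min (by positivity) (add_nonneg (ih _ _) (ih _ _))

lemma dyadicFlow_le (T : Set ℝ) (j n k : ℕ) : dyadicFlow T j n k ≤ n / 2 ^ n := by
  cases j with
  | zero => rw [dyadicFlow]; split_ifs <;> first | exact le_rfl | positivity
  | succ j => exact min_le_left _ _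

lemma dyadicFlow_le_succ (T : Set ℝ) (j n k : ℕ) :
    dyadicFlow T j n k ≤ dyadicFlow T (j + 1) n k := by
  induction j generalizing n k with
  | zero =>
    simp only [dyadicFlow]
    by_cases h : DyadicFree T n k
    · rw [if_pos h, if_pos h.left, if_pos h.right]
      refine le_min le_rfl ?_
      rw [← add_div, div_le_div_iff₀ (by positivity) (by positivity), pow_succ]
      push_cast
      nlinarith [show (0 : ℝ) < 2 ^ n by positivity]
    · rw [if_neg h]
      refine le_min (by positivity) (add_nonneg ?_ ?_) <;> split_ifs <;> positivity
  | succ j ih =>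
    rw [dyadicFlow, dyadicFlow]
    exact min_le_min le_rfl (add_le_add (ih _ _) (ih _ _))

lemma dyadicFlow_mono (T : Set ℝ) (n k : ℕ) : Monotone fun j => dyadicFlow T j n k :=
  monotone_nat_of_le_succ fun j => dyadicFlow_le_succ T j n k

/-- The limit of `dyadicFlow T j n k` for `j → ∞`. -/
def dyadicCap (T : Set ℝ) (n k : ℕ) : ℝ := ⨆ j, dyadicFlow T j n k

lemma tendsto_dyadicFlow (T : Set ℝ) (n k : ℕ) :
    Tendsto (fun j => dyadicFlow T j n k) atTop (𝓝 (dyadicCap T n k)) :=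
  tendsto_atTop_ciSup (dyadicFlow_mono T n k)
    ⟨n / 2 ^ n, by rintro _ ⟨j, rfl⟩; exact dyadicFlow_le T j n k⟩

lemma dyadicCap_eq (T : Set ℝ) (n k : ℕ) :
    dyadicCap T n k = min ((n : ℝ) / 2 ^ n)
      (dyadicCap T (n + 1) (2 * k) + dyadicCap T (n + 1) (2 * k + 1)) :=
  tendsto_nhds_unique ((tendsto_dyadicFlow T n k).comp (tendsto_add_atTop_nat 1))
    (tendsto_const_nhds.min ((tendsto_dyadicFlow T _ _).add (tendsto_dyadicFlow T _ _)))

lemma dyadicCap_le (T : Set ℝ) (n k : ℕ) : dyadicCap T n k ≤ n / 2 ^ n :=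
  ciSup_le fun j => dyadicFlow_le T j n k

lemma dyadicFlow_le_dyadicCap (T : Set ℝ) (j n k : ℕ) :
    dyadicFlow T j n k ≤ dyadicCap T n k :=
  (dyadicFlow_mono T n k).ge_of_tendsto (tendsto_dyadicFlow T n k) j

lemma dyadicCap_nonneg (T : Set ℝ) (n k : ℕ) : 0 ≤ dyadicCap T n k :=
  (dyadicFlow_nonneg T 0 n k).trans (dyadicFlow_le_dyadicCap T 0 n k)

lemma dyadicCap_of_free {T : Set ℝ} {n k : ℕ} (h : DyadicFree T n k) :
    dyadicCap T n k = n / 2 ^ n := by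
  refine (dyadicCap_le T n k).antisymm ?_
  have := dyadicFlow_le_dyadicCap T 0 n k
  rwa [dyadicFlow, if_pos h] at this

lemma setIntegral_dyadicIco_split {s : ℝ → ℝ} (n k : ℕ)
    (h1 : IntegrableOn s (dyadicIco (n + 1) (2 * k)))
    (h2 : IntegrableOn s (dyadicIco (n + 1) (2 * k + 1))) :
    ∫ t in dyadicIco n k, s t =
      (∫ t in dyadicIco (n + 1) (2 * k), s t) + ∫ t in dyadicIco (n + 1) (2 * k + 1), s t := by
  rw [dyadicIco_split, setIntegral_union (dyadicIco_children_disjoint n k)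
    (measurableSet_dyadicIco _ _) h1 h2]

lemma volume_dyadicIco_ne_top (n k : ℕ) : volume (dyadicIco n k) ≠ ⊤ := by
  rw [volume_dyadicIco]; exact ENNReal.ofReal_ne_top

lemma volume_real_dyadicIco (n k : ℕ) : volume.real (dyadicIco n k) = 1 / 2 ^ n := by
  rw [measureReal_def, volume_dyadicIco, ENNReal.toReal_ofReal (by positivity)]

lemma integrableOn_dyadicIco_of_bdd {s : ℝ → ℝ} (hs : Measurable s) {C : ℝ} (h0 : ∀ t, 0 ≤ s t)
    (hC : ∀ t, s t ≤ C) (n k : ℕ) : IntegrableOn s (dyadicIco n k) :=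
  Measure.integrableOn_of_bounded (volume_dyadicIco_ne_top n k) hs.aestronglyMeasurable
    (M := C) (Eventually.of_forall fun t => by rw [Real.norm_of_nonneg (h0 t)]; exact hC t)

/-- Every mass up to `dyadicFlow T j n k` is carried by an admissible density. -/
lemma exists_density_of_le_dyadicFlow (T : Set ℝ) (j n k : ℕ) {x : ℝ} (hx0 : 0 ≤ x)
    (hx : x ≤ dyadicFlow T j n k) :
    ∃ s : ℝ → ℝ, Measurable s ∧ (∀ t, 0 ≤ s t) ∧ (∀ t, s t ≤ (n + j : ℕ)) ∧
      (∀ t, t ∉ dyadicIco n k → s t = 0) ∧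
      (∀ l, ¬ DyadicFree T (n + j) l → ∀ t ∈ dyadicIco (n + j) l, s t = 0) ∧
      ∫ t in dyadicIco n k, s t = x ∧
      ∀ m l, n ≤ m → ∫ t in dyadicIco m l, s t ≤ m / 2 ^ m := by
  induction j generalizing n k x with
  | zero =>
    rw [dyadicFlow] at hx
    have hpow : (0 : ℝ) < 2 ^ n := by positivity
    have hxn : x * 2 ^ n ≤ n := by
      rw [← le_div_iff₀ hpow]
      refine hx.trans ?_
      split_ifs
      · exact le_rfl
      · positivity
    have hind : ∀ t, (dyadicIco n k).indicator (fun _ => x * 2 ^ n) t ≤ n := by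
      intro t
      by_cases ht : t ∈ dyadicIco n k
      · rwa [indicator_of_mem ht]
      · rw [indicator_of_notMem ht]; positivity
    have hind0 : ∀ t, 0 ≤ (dyadicIco n k).indicator (fun _ => x * 2 ^ n) t :=
      fun t => indicator_nonneg (fun _ _ => by positivity) t
    have hmeas : Measurable ((dyadicIco n k).indicator (fun _ : ℝ => x * 2 ^ n)) :=
      measurable_const.indicator (measurableSet_dyadicIco n k)
    refine ⟨(dyadicIco n k).indicator fun _ => x * 2 ^ n, hmeas, hind0, by simpa using hind,
      fun t ht => indicator_of_notMem ht _, ?_, ?_, ?_⟩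
    · intro l hl t ht
      by_cases htk : t ∈ dyadicIco n k
      · have hlk := dyadicIco_eq_of_mem htk ht
        rw [← hlk] at hl
        rw [add_zero] at hl
        rw [if_neg hl] at hx
        rw [indicator_of_mem htk, le_antisymm hx hx0, zero_mul]
      · exact indicator_of_notMem htk _
    · rw [setIntegral_indicator (measurableSet_dyadicIco n k), inter_self, setIntegral_const,
        volume_real_dyadicIco, smul_eq_mul]
      field_simp
    · intro m l hm
      calc ∫ t in dyadicIco m l, (dyadicIco n k).indicator (fun _ => x * 2 ^ n) t
          ≤ ∫ t in dyadicIco m l, (n : ℝ) :=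
            setIntegral_mono (integrableOn_dyadicIco_of_bdd hmeas hind0 hind _ _)
              (integrableOn_const (volume_dyadicIco_ne_top m l)) hind
        _ = n / 2 ^ m := by
            rw [setIntegral_const, volume_real_dyadicIco, smul_eq_mul]; ring
        _ ≤ m / 2 ^ m := by gcongr
  | succ j ih =>
    rw [dyadicFlow] at hx
    set F₁ := dyadicFlow T j (n + 1) (2 * k)
    set F₂ := dyadicFlow T j (n + 1) (2 * k + 1)
    have hx12 : x ≤ F₁ + F₂ := hx.trans (min_le_right _ _)
    have hF1 : 0 ≤ F₁ := dyadicFlow_nonneg _ _ _ _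
    have hF2 : 0 ≤ F₂ := dyadicFlow_nonneg _ _ _ _
    obtain ⟨s₁, m₁, p₁, b₁, o₁, f₁, i₁, c₁⟩ :=
      ih (n + 1) (2 * k) (x := min x F₁) (le_min hx0 hF1) (min_le_right _ _)
    obtain ⟨s₂, m₂, p₂, b₂, o₂, f₂, i₂, c₂⟩ :=
      ih (n + 1) (2 * k + 1) (x := x - min x F₁) (sub_nonneg.2 (min_le_left _ _)) (by
        rcases le_total x F₁ with h | h
        · rw [min_eq_left h, sub_self]; exact hF2
        · rw [min_eq_right h]; linarith)
    have e : n + 1 + j = n + (j + 1) := by omega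
    rw [e] at b₁ b₂ f₁ f₂
    have hdis := dyadicIco_children_disjoint n k
    have hbd : ∀ t, s₁ t + s₂ t ≤ (n + (j + 1) : ℕ) := by
      intro t
      by_cases ht : t ∈ dyadicIco (n + 1) (2 * k)
      · rw [o₂ t (Set.disjoint_left.1 hdis ht), add_zero]; exact b₁ t
      · rw [o₁ t ht, zero_add]; exact b₂ t
    have int₁ := fun m l => integrableOn_dyadicIco_of_bdd m₁ p₁ b₁ m l
    have int₂ := fun m l => integrableOn_dyadicIco_of_bdd m₂ p₂ b₂ m l
    have z₁ : ∀ S : Set ℝ, MeasurableSet S → Disjoint S (dyadicIco (n + 1) (2 * k)) →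
        ∫ t in S, s₁ t = 0 := fun S hS hd =>
      setIntegral_eq_zero_of_forall_eq_zero fun t ht => o₁ t (Set.disjoint_left.1 hd ht)
    have z₂ : ∀ S : Set ℝ, MeasurableSet S → Disjoint S (dyadicIco (n + 1) (2 * k + 1)) →
        ∫ t in S, s₂ t = 0 := fun S hS hd =>
      setIntegral_eq_zero_of_forall_eq_zero fun t ht => o₂ t (Set.disjoint_left.1 hd ht)
    have htot : ∫ t in dyadicIco n k, (s₁ t + s₂ t) = x := by
      rw [integral_add (int₁ _ _) (int₂ _ _), setIntegral_dyadicIco_split n k (int₁ _ _) (int₁ _ _),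
        setIntegral_dyadicIco_split n k (int₂ _ _) (int₂ _ _), i₁, i₂,
        z₁ _ (measurableSet_dyadicIco _ _) hdis.symm, z₂ _ (measurableSet_dyadicIco _ _) hdis]
      ring
    refine ⟨fun t => s₁ t + s₂ t, m₁.add m₂, fun t => add_nonneg (p₁ t) (p₂ t), hbd, ?_, ?_,
      htot, ?_⟩
    · intro t ht
      rw [dyadicIco_split, mem_union, not_or] at ht
      simp only [o₁ t ht.1, o₂ t ht.2, add_zero]
    · intro l hl t ht
      simp only [f₁ l hl t ht, f₂ l hl t ht, add_zero]
    · intro m l hm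
      rcases hm.eq_or_lt with rfl | hm
      · by_cases hlk : l = k
        · rw [hlk, htot]; exact hx.trans (min_le_left _ _)
        · have hd : Disjoint (dyadicIco n l) (dyadicIco n k) := dyadicIco_disjoint hlk
          rw [dyadicIco_split n k, disjoint_union_right] at hd
          rw [integral_add (int₁ _ _) (int₂ _ _), z₁ _ (measurableSet_dyadicIco _ _) hd.1,
            z₂ _ (measurableSet_dyadicIco _ _) hd.2, add_zero]
          positivity
      · by_cases hd : Disjoint (dyadicIco m l) (dyadicIco (n + 1) (2 * k))
        · rw [integral_add (int₁ _ _) (int₂ _ _), z₁ _ (measurableSet_dyadicIco _ _) hd, zero_add]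
          exact c₂ m l hm
        · obtain ⟨t, ht, ht'⟩ := Set.not_disjoint_iff.1 hd
          have hsub := dyadicIco_subset_of_mem hm ht' ht
          rw [integral_add (int₁ _ _) (int₂ _ _),
            z₂ _ (measurableSet_dyadicIco _ _) (hdis.mono_left hsub), add_zero]
          exact c₁ m l hm

open scoped Classical in
/-- The generation of the first dyadic interval around `t`, starting from `(n, k)` and looking at
`j` generations, whose capacity is full; it is `0` if there is none. -/
def stopLevel (T : Set ℝ) : ℕ → ℕ → ℕ → ℝ → ENNReal
  | 0, _, _ => fun _ => 0
  | j + 1, n, k => if dyadicCap T n k = n / 2 ^ n then (dyadicIco n k).indicator fun _ => (n : ENNReal)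
      else fun t => stopLevel T j (n + 1) (2 * k) t + stopLevel T j (n + 1) (2 * k + 1) t

lemma measurable_stopLevel (T : Set ℝ) (j n k : ℕ) : Measurable (stopLevel T j n k) := by
  induction j generalizing n k with
  | zero => exact measurable_const
  | succ j ih =>
    rw [stopLevel]
    split_ifs
    · exact measurable_const.indicator (measurableSet_dyadicIco n k)
    · exact (ih _ _).add (ih _ _)

lemma lintegral_stopLevel_le (T : Set ℝ) (j n k : ℕ) :
    ∫⁻ t, stopLevel T j n k t ≤ ENNReal.ofReal (dyadicCap T n k) := by
  induction j generalizing n k with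
  | zero => simp [stopLevel]
  | succ j ih =>
    rw [stopLevel]
    split_ifs with h
    · rw [lintegral_indicator_const (measurableSet_dyadicIco n k), volume_dyadicIco, h,
        ← ENNReal.ofReal_natCast, ← ENNReal.ofReal_mul (by positivity), mul_one_div]
    · rw [lintegral_add_left (measurable_stopLevel _ _ _ _)]
      have h2 : dyadicCap T n k =
          dyadicCap T (n + 1) (2 * k) + dyadicCap T (n + 1) (2 * k + 1) := by
        have := dyadicCap_eq T n k
        rcases min_choice ((n : ℝ) / 2 ^ n)
          (dyadicCap T (n + 1) (2 * k) + dyadicCap T (n + 1) (2 * k + 1)) with h' | h' <;>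
          rw [h'] at this
        · exact absurd this h
        · exact this
      rw [h2, ENNReal.ofReal_add (dyadicCap_nonneg _ _ _) (dyadicCap_nonneg _ _ _)]
      exact add_le_add (ih _ _) (ih _ _)

lemma stopLevel_le_succ (T : Set ℝ) (j n k : ℕ) (t : ℝ) :
    stopLevel T j n k t ≤ stopLevel T (j + 1) n k t := by
  induction j generalizing n k with
  | zero => exact zero_le
  | succ j ih =>
    rw [stopLevel, stopLevel]
    split_ifs
    · exact le_rfl
    · exact add_le_add (ih _ _) (ih _ _)

/-- Where `stopLevel` does not vanish, it is constant on a dyadic interval of that generation. -/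
lemma stopLevel_structure (T : Set ℝ) (j n k : ℕ) {t : ℝ} (h : stopLevel T j n k t ≠ 0) :
    ∃ m l, n ≤ m ∧ t ∈ dyadicIco m l ∧ dyadicIco m l ⊆ dyadicIco n k ∧
      ∀ u ∈ dyadicIco m l, (m : ENNReal) ≤ stopLevel T j n k u := by
  induction j generalizing n k with
  | zero => exact absurd rfl h
  | succ j ih =>
    rw [stopLevel] at h ⊢
    split_ifs at h ⊢ with hg
    · have ht : t ∈ dyadicIco n k := by
        by_contra ht
        exact h (indicator_of_notMem ht _)
      exact ⟨n, k, le_rfl, ht, Subset.rfl, fun u hu => (indicator_of_mem hu fun _ => (n : ENNReal)).ge⟩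
    · have h' : stopLevel T j (n + 1) (2 * k) t ≠ 0 ∨ stopLevel T j (n + 1) (2 * k + 1) t ≠ 0 := by
        by_contra hc
        push Not at hc
        exact h (by simp only [hc.1, hc.2, add_zero])
      rcases h' with h' | h'
      · obtain ⟨m, l, hm, ht, hs, hu⟩ := ih _ _ h'
        exact ⟨m, l, by omega, ht, hs.trans ((dyadicIco_split n k).symm ▸ subset_union_left),
          fun u hu' => (hu u hu').trans le_self_add⟩
      · obtain ⟨m, l, hm, ht, hs, hu⟩ := ih _ _ h'
        exact ⟨m, l, by omega, ht, hs.trans ((dyadicIco_split n k).symm ▸ subset_union_right),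
          fun u hu' => (hu u hu').trans le_add_self⟩

lemma le_stopLevel_of_full (T : Set ℝ) (j n k : ℕ) {t : ℝ} {m l : ℕ} (hn : n ≤ m) (hm : m < n + j)
    (ht : t ∈ dyadicIco n k) (ht' : t ∈ dyadicIco m l) (hf : dyadicCap T m l = m / 2 ^ m) :
    (n : ENNReal) ≤ stopLevel T j n k t := by
  induction j generalizing n k with
  | zero => omega
  | succ j ih =>
    rw [stopLevel]
    split_ifs with hg
    · exact (indicator_of_mem ht fun _ => (n : ENNReal)).ge
    · rcases hn.eq_or_lt with rfl | hn
      · rw [dyadicIco_eq_of_mem ht ht'] at hg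
        exact absurd hf hg
      · have hle : (n : ENNReal) ≤ ((n + 1 : ℕ) : ENNReal) := by exact_mod_cast Nat.le_succ n
        rw [dyadicIco_split] at ht
        rcases ht with ht | ht
        · exact hle.trans ((ih (n + 1) (2 * k) hn (by omega) ht).trans le_self_add)
        · exact hle.trans ((ih (n + 1) (2 * k + 1) hn (by omega) ht).trans le_add_self)

lemma le_stopLevel_of_ne_zero (T : Set ℝ) (j n k : ℕ) {t : ℝ} (h : stopLevel T j n k t ≠ 0) :
    (n : ENNReal) ≤ stopLevel T j n k t := by
  obtain ⟨m, l, hm, ht, -, hu⟩ := stopLevel_structure T j n k h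
  exact le_trans (by exact_mod_cast hm) (hu t ht)

/-- If the capacity of `(n, k)` is not full, then `T` has a part `Z` of positive length in the dyadic
interval whose complement there is covered by dyadic intervals of finite entropy. -/
lemma exists_finite_entropy {T : Set ℝ} (hT : IsClosed T) {n k : ℕ}
    (hlt : dyadicCap T n k < n / 2 ^ n) :
    ∃ (Z : Set ℝ) (w : ℝ → ENNReal), Z ⊆ T ∧ Z ⊆ dyadicIco n k ∧ volume Z ≠ 0 ∧ Measurable w ∧
      ∫⁻ t, w t ≠ ⊤ ∧ ∀ t ∈ dyadicIco n k, t ∉ Z → ∃ m l, t ∈ dyadicIco m l ∧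
        Disjoint (dyadicIco m l) Z ∧ (m : ENNReal) ≤ w t := by
  have hn : n ≠ 0 := by
    rintro rfl
    have := dyadicCap_nonneg T 0 k
    simp at hlt
    linarith
  have hn' : (0 : ENNReal) < n := by exact_mod_cast Nat.pos_of_ne_zero hn
  set w : ℝ → ENNReal := fun t => ⨆ j, stopLevel T j n k t with hw
  have hwm : Measurable w := Measurable.iSup fun j => measurable_stopLevel T j n k
  have hle : ∀ j t, stopLevel T j n k t ≤ w t := fun j t => le_iSup (fun j => stopLevel T j n k t) j
  have hmass : ∫⁻ t, w t ≤ ENNReal.ofReal (dyadicCap T n k) := by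
    rw [hw, lintegral_iSup (fun j => measurable_stopLevel T j n k)
      (monotone_nat_of_le_succ fun j t => stopLevel_le_succ T j n k t)]
    exact iSup_le fun j => lintegral_stopLevel_le T j n k
  have hne : ∀ t, w t ≠ 0 → ∃ j, stopLevel T j n k t ≠ 0 := by
    intro t ht
    by_contra hc
    push Not at hc
    exact ht (by simp [hw, hc])
  refine ⟨{t ∈ dyadicIco n k | w t = 0}, w, ?_, fun t ht => ht.1, ?_, hwm,
    (hmass.trans_lt ENNReal.ofReal_lt_top).ne, ?_⟩
  · rintro t ⟨ht, hwt⟩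
    by_contra htT
    have ht0 : 0 ≤ t := le_trans (by positivity) ht.1
    obtain ⟨m, l, hnm, htm, hfree⟩ := exists_dyadicFree hT ht0 htT n
    have h1 := le_stopLevel_of_full T (m + 1) n k hnm (by omega) ht htm (dyadicCap_of_free hfree)
    exact (hn'.trans_le (h1.trans (hle _ t))).ne' hwt
  · intro hvol
    have h1 : ∀ᵐ t, (dyadicIco n k).indicator (fun _ => (n : ENNReal)) t ≤ w t := by
      filter_upwards [measure_eq_zero_iff_ae_notMem.1 hvol] with t ht
      by_cases htk : t ∈ dyadicIco n k
      · rw [indicator_of_mem htk]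
        obtain ⟨j, hj⟩ := hne t fun h0 => ht ⟨htk, h0⟩
        exact (le_stopLevel_of_ne_zero T j n k hj).trans (hle j t)
      · rw [indicator_of_notMem htk]; exact zero_le
    have h2 := (lintegral_mono_ae h1).trans hmass
    rw [lintegral_indicator_const (measurableSet_dyadicIco n k), volume_dyadicIco,
      ← ENNReal.ofReal_natCast, ← ENNReal.ofReal_mul (by positivity), mul_one_div,
      ENNReal.ofReal_le_ofReal_iff (dyadicCap_nonneg T n k)] at h2
    exact absurd hlt h2.not_gt
  · intro t ht htZ
    have hwt : w t ≠ 0 := fun h0 => htZ ⟨ht, h0⟩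
    obtain ⟨j, hj⟩ := hne t hwt
    obtain ⟨m, l, hnm, htm, hs, hu⟩ := stopLevel_structure T j n k hj
    refine ⟨m, l, htm, ?_, (hu t htm).trans (hle j t)⟩
    rw [Set.disjoint_left]
    rintro u hum ⟨-, hu0⟩
    have hm0 : (0 : ENNReal) < m := hn'.trans_le (by exact_mod_cast hnm)
    exact (hm0.trans_le ((hu u hum).trans (hle j u))).ne' hu0

/-- A bounded open set of reals is a disjoint union of a sequence of (possibly empty) bounded open
intervals. -/
lemma exists_disjoint_Ioo_of_isOpen {U : Set ℝ} (hU : IsOpen U) {c d : ℝ} (hcd : c ≤ d)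
    (hUb : U ⊆ Ioo c d) :
    ∃ a b : ℕ → ℝ, (∀ i, a i ≤ b i) ∧ (∀ i, c ≤ a i ∧ b i ≤ d) ∧
      Pairwise (Function.onFun Disjoint fun i => Ioo (a i) (b i)) ∧ U = ⋃ i, Ioo (a i) (b i) := by
  rcases U.eq_empty_or_nonempty with rfl | -
  · exact ⟨fun _ => c, fun _ => c, fun _ => le_rfl, fun _ => ⟨le_rfl, hcd⟩,
      fun i j _ => by simp [Function.onFun], by simp⟩
  have hsub : ∀ x, U.ordConnectedComponent x ⊆ U := fun x => ordConnectedComponent_subset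
  have hopen : ∀ x, IsOpen (U.ordConnectedComponent x) := by
    intro x
    rw [isOpen_iff_mem_nhds]
    intro y hy
    rw [ordConnectedComponent_eq hy]
    exact ordConnectedComponent_mem_nhds.2 (hU.mem_nhds (hsub x hy))
  have hbb : ∀ x, BddBelow (U.ordConnectedComponent x) := fun x =>
    ⟨c, fun y hy => (hUb (hsub x hy)).1.le⟩
  have hba : ∀ x, BddAbove (U.ordConnectedComponent x) := fun x =>
    ⟨d, fun y hy => (hUb (hsub x hy)).2.le⟩
  have hIoo : ∀ x ∈ U, U.ordConnectedComponent x =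
      Ioo (sInf (U.ordConnectedComponent x)) (sSup (U.ordConnectedComponent x)) := by
    intro x hx
    apply Subset.antisymm
    · intro y hy
      obtain ⟨ε, hε, hball⟩ := Metric.isOpen_iff.1 (hopen x) y hy
      have h1 : y - ε / 2 ∈ U.ordConnectedComponent x :=
        hball (by rw [mem_ball, Real.dist_eq, abs_lt]; constructor <;> linarith)
      have h2 : y + ε / 2 ∈ U.ordConnectedComponent x :=
        hball (by rw [mem_ball, Real.dist_eq, abs_lt]; constructor <;> linarith)
      exact ⟨(csInf_le (hbb x) h1).trans_lt (by linarith),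
        lt_of_lt_of_le (by linarith) (le_csSup (hba x) h2)⟩
    · have hoc : (U.ordConnectedComponent x).OrdConnected := inferInstance
      exact IsConnected.Ioo_csInf_csSup_subset
        ⟨⟨x, self_mem_ordConnectedComponent.2 hx⟩, hoc.isPreconnected⟩ (hbb x) (hba x)
  set q := TopologicalSpace.denseSeq ℝ with hq
  let P : ℕ → Prop := fun i => q i ∈ U ∧ ∀ j < i, q j ∉ U.ordConnectedComponent (q i)
  classical
  have hB : ∀ i, Ioo (if P i then sInf (U.ordConnectedComponent (q i)) else c)
      (if P i then sSup (U.ordConnectedComponent (q i)) else c) =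
      if P i then U.ordConnectedComponent (q i) else ∅ := by
    intro i
    by_cases h : P i
    · simp only [if_pos h]; exact (hIoo _ h.1).symm
    · simp only [if_neg h, Ioo_self]
  refine ⟨fun i => if P i then sInf (U.ordConnectedComponent (q i)) else c,
    fun i => if P i then sSup (U.ordConnectedComponent (q i)) else c, ?_, ?_, ?_, ?_⟩
  · intro i
    by_cases h : P i
    · simp only [if_pos h]
      have := self_mem_ordConnectedComponent.2 h.1
      exact (csInf_le (hbb _) this).trans (le_csSup (hba _) this)
    · simp only [if_neg h, le_rfl]
  · intro i
    by_cases h : P i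
    · simp only [if_pos h]
      have hne : (U.ordConnectedComponent (q i)).Nonempty :=
        ⟨_, self_mem_ordConnectedComponent.2 h.1⟩
      exact ⟨le_csInf hne fun y hy => (hUb (hsub _ hy)).1.le,
        csSup_le hne fun y hy => (hUb (hsub _ hy)).2.le⟩
    · simp only [if_neg h]; exact ⟨le_rfl, hcd⟩
  · have key : ∀ i j, i < j → P i → P j → Disjoint (U.ordConnectedComponent (q i))
        (U.ordConnectedComponent (q j)) := by
      intro i j hij hi hj
      rw [Set.disjoint_left]
      intro x hx hx'
      apply hj.2 i hij
      rw [ordConnectedComponent_eq hx', ← ordConnectedComponent_eq hx]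
      exact self_mem_ordConnectedComponent.2 hi.1
    intro i j hij
    simp only [Function.onFun, hB]
    by_cases hi : P i <;> by_cases hj : P j <;> simp only [hi, hj, if_true, if_false,
      disjoint_empty, empty_disjoint]
    rcases hij.lt_or_gt with h | h
    · exact key i j h hi hj
    · exact (key j i h hj hi).symm
  · ext x
    simp only [hB, mem_iUnion]
    constructor
    · intro hx
      have hex : ∃ i, q i ∈ U.ordConnectedComponent x := by
        obtain ⟨y, hy, i, rfl⟩ := (TopologicalSpace.denseRange_denseSeq ℝ).inter_open_nonempty _
          (hopen x) ⟨x, self_mem_ordConnectedComponent.2 hx⟩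
        exact ⟨i, hy⟩
      have heq := ordConnectedComponent_eq (Nat.find_spec hex)
      refine ⟨Nat.find hex, ?_⟩
      have hP : P (Nat.find hex) := by
        refine ⟨hsub _ (Nat.find_spec hex), fun j hj => ?_⟩
        rw [← heq]
        exact Nat.find_min hex hj
      rw [if_pos hP, ← heq]
      exact self_mem_ordConnectedComponent.2 hx
    · rintro ⟨i, hi⟩
      split_ifs at hi
      · exact hsub _ hi
      · exact absurd hi (notMem_empty x)

/-- The parametrisation `t ↦ e ^ (2 π i t)` of the unit circle. -/
def circleExp (t : ℝ) : ℂ := Complex.exp (((2 * Real.pi * t : ℝ) : ℂ) * Complex.I)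

lemma continuous_circleExp : Continuous circleExp := by
  unfold circleExp
  fun_prop

lemma norm_circleExp (t : ℝ) : ‖circleExp t‖ = 1 := Complex.norm_exp_ofReal_mul_I _

lemma circleExp_eq_iff {s t : ℝ} : circleExp s = circleExp t ↔ ∃ n : ℤ, s = t + n := by
  rw [circleExp, circleExp, Complex.exp_eq_exp_iff_exists_int]
  refine exists_congr fun n => ?_
  rw [show ((2 * Real.pi * t : ℝ) : ℂ) * Complex.I + n * (2 * Real.pi * Complex.I) =
    ((2 * Real.pi * (t + n) : ℝ) : ℂ) * Complex.I by push_cast; ring,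
    mul_left_inj' Complex.I_ne_zero, Complex.ofReal_inj,
    mul_right_inj' (by positivity : (2 * Real.pi : ℝ) ≠ 0)]

lemma injOn_circleExp (a : ℝ) : InjOn circleExp (Ico a (a + 1)) := by
  intro s hs t ht h
  obtain ⟨n, hn⟩ := circleExp_eq_iff.1 h
  have h1 : (n : ℝ) < 1 := by linarith [hs.2, ht.1]
  have h2 : (-1 : ℝ) < n := by linarith [hs.1, ht.2]
  have h3 : n = 0 := by
    have h1' : n < 1 := by exact_mod_cast h1
    have h2' : -1 < n := by exact_mod_cast h2
    omega
  rw [hn, h3, Int.cast_zero, add_zero]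

lemma exists_circleExp_eq (a : ℝ) {x : ℂ} (hx : ‖x‖ = 1) :
    ∃ t ∈ Ico a (a + 1), circleExp t = x := by
  have h1 : circleExp (x.arg / (2 * Real.pi)) = x := by
    rw [circleExp, mul_div_cancel₀ _ (by positivity)]
    have := Complex.norm_mul_exp_arg_mul_I x
    rwa [hx, Complex.ofReal_one, one_mul] at this
  refine ⟨toIcoMod one_pos a (x.arg / (2 * Real.pi)), toIcoMod_mem_Ico one_pos a _, ?_⟩
  rw [← h1, circleExp_eq_iff, h1]
  refine ⟨-toIcoDiv one_pos a (x.arg / (2 * Real.pi)), ?_⟩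
  rw [toIcoMod]
  simp [sub_eq_add_neg]

lemma circleExp_image_Ioo (a b : ℝ) : circleExp '' Ioo a b =
    (fun θ : ℝ => Complex.exp ((θ : ℂ) * Complex.I)) '' Ioo (2 * Real.pi * a) (2 * Real.pi * b) := by
  have hpi : 0 < 2 * Real.pi := by positivity
  have : Ioo (2 * Real.pi * a) (2 * Real.pi * b) = (fun t => 2 * Real.pi * t) '' Ioo a b := by
    rw [Set.image_mul_left_Ioo hpi]
  rw [this, image_image]
  rfl

lemma isOpenArc_circleExp_image {a b : ℝ} (hab : a < b) (hb : b ≤ a + 1) :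
    IsOpenArc (circleExp '' Ioo a b) := by
  have hpi : 0 < 2 * Real.pi := by positivity
  refine ⟨2 * Real.pi * a, 2 * Real.pi * b, by gcongr, ?_, circleExp_image_Ioo a b⟩
  nlinarith

lemma arcMeasure_circleExp_image {a b : ℝ} (ha : 0 ≤ a) (hb : b ≤ 1) :
    arcMeasure (circleExp '' Ioo a b) = ENNReal.ofReal (2 * Real.pi * (b - a)) := by
  have hpi : 0 < 2 * Real.pi := by positivity
  have : {θ : ℝ | θ ∈ Ico (0 : ℝ) (2 * Real.pi) ∧
      Complex.exp ((θ : ℂ) * Complex.I) ∈ circleExp '' Ioo a b} =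
      Ioo (2 * Real.pi * a) (2 * Real.pi * b) := by
    ext θ
    constructor
    · rintro ⟨hθ, t, ht, h⟩
      have h1 : Complex.exp ((θ : ℂ) * Complex.I) = circleExp (θ / (2 * Real.pi)) := by
        rw [circleExp, mul_div_cancel₀ _ hpi.ne']
      have h2 : t = θ / (2 * Real.pi) := by
        refine injOn_circleExp 0 ⟨by linarith [ht.1], by linarith [ht.2]⟩ ⟨?_, ?_⟩ (h.trans h1)
        · exact div_nonneg hθ.1 hpi.le
        · rw [zero_add, div_lt_one hpi]; exact hθ.2
      rw [h2, mem_Ioo, lt_div_iff₀ hpi, div_lt_iff₀ hpi] at ht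
      constructor <;> linarith [ht.1, ht.2]
    · intro hθ
      refine ⟨⟨?_, ?_⟩, ?_⟩
      · exact le_trans (by positivity) hθ.1.le
      · nlinarith [hθ.2]
      · rw [circleExp_image_Ioo]
        exact ⟨θ, hθ, rfl⟩
  rw [arcMeasure, this, Real.volume_Ioo]
  congr 1
  ring

lemma arcMeasure_ne_zero_of_circleExp {E : Set ℂ} {Z : Set ℝ} (hZ : Z ⊆ Ico 0 1)
    (hZE : ∀ t ∈ Z, circleExp t ∈ E) (hv : volume Z ≠ 0) : arcMeasure E ≠ 0 := by
  have hpi : 0 < 2 * Real.pi := by positivity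
  intro h0
  rw [arcMeasure] at h0
  apply hv
  have h1 := Real.volume_preimage_mul_left hpi.ne' {θ : ℝ | θ ∈ Ico (0 : ℝ) (2 * Real.pi) ∧
      Complex.exp ((θ : ℂ) * Complex.I) ∈ E}
  rw [h0, mul_zero] at h1
  refine measure_mono_null ?_ h1
  intro t ht
  refine ⟨⟨mul_nonneg hpi.le (hZ ht).1, ?_⟩, ?_⟩
  · nlinarith [(hZ ht).2]
  · exact hZE t ht

lemma BergmanAdmissible.not_satisfiesCarleson {K E : Set ℂ} (hK : BergmanAdmissible K)
    (hEK : E ⊆ K) (hE : IsCompact E) (h0 : arcMeasure E ≠ 0) : ¬ SatisfiesCarleson E := by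
  rcases hK with ⟨-, h⟩ | h
  · exact h E hEK hE h0
  · unfold arcMeasure at h h0
    refine absurd (measure_mono_null ?_ h) h0
    exact fun θ hθ => ⟨hθ.1, hEK hθ.2⟩

/-- The entropy bound for a gap `(a, b)` of `Z`: its length satisfies
`(b - a) log (1 / (b - a)) ≤ log 2 * ∫ w` if `w` dominates the generation of dyadic intervals
inside the gap. -/
lemma gap_entropy_le {Z : Set ℝ} {w : ℝ → ENNReal} {a b : ℝ} (hab : a < b)
    (ha : a ∈ closure Z) (hb : b ∈ closure Z)
    (h : ∀ t ∈ Ioo a b, ∃ m l, t ∈ dyadicIco m l ∧ Disjoint (dyadicIco m l) Z ∧ (m : ENNReal) ≤ w t)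
    (hfin : ∫⁻ t in Ioo a b, w t ≠ ⊤) :
    (b - a) * Real.log (1 / (b - a)) ≤ Real.log 2 * (∫⁻ t in Ioo a b, w t).toReal := by
  have hl2 : 0 < Real.log 2 := Real.log_pos one_lt_two
  have hba : 0 < b - a := sub_pos.2 hab
  set C := Real.log (1 / (b - a)) / Real.log 2 with hC
  have hcount : (⋃ (m : ℕ) (l : ℕ), {((l : ℝ) / 2 ^ m)}).Countable :=
    countable_iUnion fun m => countable_iUnion fun l => countable_singleton _
  have hae : ∀ᵐ t ∂volume.restrict (Ioo a b), ENNReal.ofReal C ≤ w t := by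
    rw [ae_restrict_iff' measurableSet_Ioo]
    filter_upwards [hcount.ae_notMem volume] with t htc ht
    obtain ⟨m, l, htm, hd, hw⟩ := h t ht
    refine le_trans ?_ hw
    rw [← ENNReal.ofReal_natCast]
    apply ENNReal.ofReal_le_ofReal
    rw [hC, div_le_iff₀ hl2, ← Real.log_pow]
    have htl : (l : ℝ) / 2 ^ m ≠ t := fun h' => htc (mem_iUnion.2 ⟨m, mem_iUnion.2 ⟨l, h'.symm⟩⟩)
    rw [dyadicIco] at htm hd
    have htl' : (l : ℝ) / 2 ^ m < t := lt_of_le_of_ne htm.1 htl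
    have hdc : Disjoint (Ioo ((l : ℝ) / 2 ^ m) ((l + 1) / 2 ^ m)) (closure Z) :=
      (hd.mono_left Ioo_subset_Ico_self).closure_right isOpen_Ioo
    have ha' : a ≤ l / 2 ^ m := by
      by_contra hc
      push Not at hc
      exact Set.disjoint_left.1 hdc ⟨hc, ht.1.trans htm.2⟩ ha
    have hb' : ((l : ℝ) + 1) / 2 ^ m ≤ b := by
      by_contra hc
      push Not at hc
      exact Set.disjoint_left.1 hdc ⟨htl'.trans ht.2, hc⟩ hb
    have hle : (1 : ℝ) / 2 ^ m ≤ b - a := by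
      have : ((l : ℝ) + 1) / 2 ^ m = l / 2 ^ m + 1 / 2 ^ m := by ring
      linarith
    apply Real.log_le_log (by positivity)
    rw [div_le_iff₀ hba]
    rw [div_le_iff₀ (by positivity)] at hle
    linarith
  have hmass := lintegral_mono_ae hae
  rw [lintegral_const, Measure.restrict_apply_univ, Real.volume_Ioo] at hmass
  have h2 := ENNReal.toReal_mono hfin hmass
  rw [ENNReal.toReal_mul, ENNReal.toReal_ofReal hba.le] at h2
  have h3 : C * (b - a) ≤ (∫⁻ t in Ioo a b, w t).toReal :=
    le_trans (by gcongr; rw [ENNReal.toReal_ofReal']; exact le_max_left _ _) h2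
  calc (b - a) * Real.log (1 / (b - a)) = Real.log 2 * (C * (b - a)) := by
        rw [hC]; field_simp
    _ ≤ _ := by gcongr

lemma satisfiesCarleson_of_gaps {Z : Set ℝ} {w : ℝ → ENNReal} {n k : ℕ} (hn : n ≠ 0)
    (hk : k < 2 ^ n) (hZ : Z ⊆ dyadicIco n k) (hZne : Z.Nonempty) (hfin : ∫⁻ t, w t ≠ ⊤)
    (h : ∀ t ∈ dyadicIco n k, t ∉ Z → ∃ m l, t ∈ dyadicIco m l ∧
      Disjoint (dyadicIco m l) Z ∧ (m : ENNReal) ≤ w t) :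
    SatisfiesCarleson (circleExp '' closure Z) := by
  have hpi : 0 < 2 * Real.pi := by positivity
  set a₀ : ℝ := (k : ℝ) / 2 ^ n with ha₀
  set b₀ : ℝ := ((k : ℝ) + 1) / 2 ^ n with hb₀
  have ha₀0 : 0 ≤ a₀ := by positivity
  have hb₀1 : b₀ ≤ 1 := by
    rw [hb₀, div_le_one (by positivity)]
    exact_mod_cast hk
  have hlen : b₀ < a₀ + 1 := by
    have h1 : b₀ = a₀ + 1 / 2 ^ n := by rw [hb₀, ha₀]; ring
    have h2 : (1 : ℝ) / 2 ^ n < 1 := by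
      rw [div_lt_one (by positivity)]
      exact one_lt_pow₀ one_lt_two hn
    linarith
  have hEsub : closure Z ⊆ Icc a₀ b₀ := by
    refine closure_minimal (hZ.trans Ico_subset_Icc_self) isClosed_Icc
  have hEne : (closure Z).Nonempty := hZne.closure
  have hbb : BddBelow (closure Z) := bddBelow_Icc.mono hEsub
  have hba : BddAbove (closure Z) := bddAbove_Icc.mono hEsub
  set α := sInf (closure Z) with hα
  set β := sSup (closure Z) with hβ
  have hαE : α ∈ closure Z := isClosed_closure.csInf_mem hEne hbb
  have hβE : β ∈ closure Z := isClosed_closure.csSup_mem hEne hba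
  have hαβ : α ≤ β := csInf_le hbb hβE
  have hEαβ : ∀ s ∈ closure Z, α ≤ s ∧ s ≤ β := fun s hs => ⟨csInf_le hbb hs, le_csSup hba hs⟩
  have hβ1 : β < α + 1 := by linarith [(hEsub hαE).1, (hEsub hβE).2]
  obtain ⟨a, b, hle, hbd, hdis, hU⟩ := exists_disjoint_Ioo_of_isOpen
    (isOpen_Ioo.sdiff isClosed_closure : IsOpen (Ioo α β \ closure Z)) hαβ sdiff_subset
  have hsubU : ∀ i, Ioo (a i) (b i) ⊆ Ioo α β \ closure Z := fun i => by
    rw [hU]; exact subset_iUnion (fun i => Ioo (a i) (b i)) i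
  have hend : ∀ i, a i < b i → a i ∈ closure Z ∧ b i ∈ closure Z := by
    intro i hi
    have hout : ∀ x ∈ Icc (a i) (b i), x ∉ Ioo (a i) (b i) → x ∈ closure Z := by
      intro x hx hxn
      by_contra hxE
      have hxα : x ≠ α := fun h => hxE (h ▸ hαE)
      have hxβ : x ≠ β := fun h => hxE (h ▸ hβE)
      have hxU : x ∈ Ioo α β \ closure Z :=
        ⟨⟨lt_of_le_of_ne ((hbd i).1.trans hx.1) hxα.symm,
          lt_of_le_of_ne (hx.2.trans (hbd i).2) hxβ⟩, hxE⟩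
      rw [hU, mem_iUnion] at hxU
      obtain ⟨j, hj⟩ := hxU
      have hij : i ≠ j := fun h => hxn (h ▸ hj)
      have hd : Disjoint (Ioo (a i) (b i)) (Ioo (a j) (b j)) := hdis hij
      have hd' := hd.closure_left isOpen_Ioo
      rw [closure_Ioo hi.ne] at hd'
      exact Set.disjoint_left.1 hd' hx hj
    exact ⟨hout _ (left_mem_Icc.2 hi.le) (by simp), hout _ (right_mem_Icc.2 hi.le) (by simp)⟩
  have hIco : ∀ i, Ioo (a i) (b i) ⊆ Ico α (α + 1) := fun i x hx =>
    ⟨(hsubU i hx).1.1.le, (hsubU i hx).1.2.trans hβ1⟩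
  have hIco0 : Ioo β (α + 1) ⊆ Ico α (α + 1) := fun x hx => ⟨hαβ.trans hx.1.le, hx.2⟩
  have hdisj : ∀ {S S' : Set ℝ}, S ⊆ Ico α (α + 1) → S' ⊆ Ico α (α + 1) → Disjoint S S' →
      Disjoint (circleExp '' S) (circleExp '' S') := by
    intro S S' hS hS' hd
    rw [Set.disjoint_left]
    rintro _ ⟨s, hs, rfl⟩ ⟨t, ht, h⟩
    have := injOn_circleExp α (hS' ht) (hS hs) h
    exact Set.disjoint_left.1 hd hs (this ▸ ht)
  have hd0 : ∀ i, Disjoint (Ioo β (α + 1)) (Ioo (a i) (b i)) := fun i =>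
    Set.disjoint_left.2 fun x hx hx' => absurd (hsubU i hx').1.2 hx.1.not_gt
  refine ⟨fun i => Nat.casesOn i (circleExp '' Ioo β (α + 1)) fun i => circleExp '' Ioo (a i) (b i),
    ?_, ?_, ?_, ?_⟩
  · rintro (_ | i)
    · exact Or.inl (isOpenArc_circleExp_image hβ1 (by linarith))
    · rcases (hle i).eq_or_lt with h | h
      · right; simp [h]
      · exact Or.inl (isOpenArc_circleExp_image h (by linarith [(hbd i).1, (hbd i).2]))
  · rintro (_ | i) (_ | j) hij
    · exact absurd rfl hij
    · exact hdisj hIco0 (hIco j) (hd0 j)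
    · exact hdisj (hIco i) hIco0 (hd0 i).symm
    · exact hdisj (hIco i) (hIco j) (hdis (by omega))
  · ext x
    rw [mem_iUnion]
    constructor
    · rintro ⟨hx, hxE⟩
      obtain ⟨t, ht, rfl⟩ := exists_circleExp_eq α (by simpa using hx : ‖x‖ = 1)
      have htE : t ∉ closure Z := fun h => hxE ⟨t, h, rfl⟩
      have htα : t ≠ α := fun h => htE (h ▸ hαE)
      have htβ : t ≠ β := fun h => htE (h ▸ hβE)
      rcases lt_or_gt_of_ne htβ with h' | h'
      · have htU : t ∈ Ioo α β \ closure Z := ⟨⟨lt_of_le_of_ne ht.1 htα.symm, h'⟩, htE⟩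
        rw [hU, mem_iUnion] at htU
        obtain ⟨i, hi⟩ := htU
        exact ⟨i + 1, t, hi, rfl⟩
      · exact ⟨0, t, ⟨h', ht.2⟩, rfl⟩
    · have key : ∀ t ∈ Ico α (α + 1), t ∉ closure Z →
          circleExp t ∈ sphere (0 : ℂ) 1 \ circleExp '' closure Z := by
        intro t ht htE
        refine ⟨by simp [norm_circleExp], ?_⟩
        rintro ⟨s, hs, hst⟩
        have := injOn_circleExp α ⟨(hEαβ s hs).1, (hEαβ s hs).2.trans_lt hβ1⟩ ht hst
        exact htE (this ▸ hs)
      rintro ⟨_ | i, t, ht, rfl⟩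
      · exact key t (hIco0 ht) fun h => absurd (hEαβ t h).2 ht.1.not_ge
      · exact key t (hIco i ht) (hsubU i ht).2
  · rw [← summable_nat_add_iff 1]
    have ha0 : ∀ i, 0 ≤ a i := fun i => (ha₀0.trans (hEsub hαE).1).trans (hbd i).1
    have hb1 : ∀ i, b i ≤ 1 := fun i => (hbd i).2.trans ((hEsub hβE).2.trans hb₀1)
    have hx : ∀ i, (arcMeasure (circleExp '' Ioo (a i) (b i))).toReal = 2 * Real.pi * (b i - a i) :=
      fun i => by
        rw [arcMeasure_circleExp_image (ha0 i) (hb1 i),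
          ENNReal.toReal_ofReal (mul_nonneg hpi.le (sub_nonneg.2 (hle i)))]
    have hsumw : ∑' i, ∫⁻ t in Ioo (a i) (b i), w t ≠ ⊤ := by
      rw [← lintegral_iUnion (fun i => measurableSet_Ioo) hdis]
      exact ((setLIntegral_le_lintegral _ _).trans_lt hfin.lt_top).ne
    have hS1 := ENNReal.summable_toReal hsumw
    have hsumv : ∑' i, volume (Ioo (a i) (b i)) ≠ ⊤ := by
      rw [← measure_iUnion hdis fun i => measurableSet_Ioo, ← hU]
      exact ((measure_mono sdiff_subset).trans_lt measure_Ioo_lt_top).ne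
    have hS2 := ENNReal.summable_toReal hsumv
    refine Summable.of_norm_bounded
      (((hS1.mul_left (2 * Real.pi * Real.log 2))).add
        (hS2.mul_left (2 * Real.pi * Real.log (2 * Real.pi)))) fun i => ?_
    change ‖(arcMeasure (circleExp '' Ioo (a i) (b i))).toReal *
      Real.log (1 / (arcMeasure (circleExp '' Ioo (a i) (b i))).toReal)‖ ≤ _
    rw [hx i, Real.volume_Ioo, ENNReal.toReal_ofReal (sub_nonneg.2 (hle i))]
    have hl2π : 0 ≤ Real.log (2 * Real.pi) :=
      Real.log_nonneg (by linarith [Real.pi_gt_three])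
    have hw0 : 0 ≤ (∫⁻ t in Ioo (a i) (b i), w t).toReal := ENNReal.toReal_nonneg
    have hl2 : 0 < Real.log 2 := Real.log_pos one_lt_two
    rcases (hle i).eq_or_lt with hi | hi
    · rw [hi, sub_self, mul_zero, zero_mul, norm_zero]
      positivity
    · have hδ : 0 < b i - a i := sub_pos.2 hi
      have hent := gap_entropy_le hi (hend i hi).1 (hend i hi).2 (w := w) (fun t ht => by
          refine h t ⟨?_, ?_⟩ fun htZ => (hsubU i ht).2 (subset_closure htZ)
          · linarith [(hsubU i ht).1.1, (hEsub hαE).1]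
          · linarith [(hsubU i ht).1.2, (hEsub hβE).2])
        ((setLIntegral_le_lintegral _ _).trans_lt hfin.lt_top).ne
      have hlog0 : 0 ≤ Real.log (1 / (b i - a i)) := by
        apply Real.log_nonneg
        rw [le_div_iff₀ hδ]
        linarith [ha0 i, hb1 i]
      have hlogx : Real.log (1 / (2 * Real.pi * (b i - a i))) =
          Real.log (1 / (b i - a i)) - Real.log (2 * Real.pi) := by
        rw [one_div, one_div, Real.log_inv, Real.log_inv, Real.log_mul hpi.ne' hδ.ne']
        ring
      rw [hlogx, Real.norm_eq_abs, abs_le]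
      have e1 : 0 ≤ 2 * Real.pi * (b i - a i) * Real.log (2 * Real.pi) := by positivity
      have e2 : 0 ≤ 2 * Real.pi * ((b i - a i) * Real.log (1 / (b i - a i))) := by positivity
      have e3 := mul_le_mul_of_nonneg_left hent hpi.le
      have e4 : 0 ≤ 2 * Real.pi * (Real.log 2 * (∫⁻ t in Ioo (a i) (b i), w t).toReal) := by
        positivity
      constructor <;> nlinarith

/-- For an admissible set all dyadic capacities are full. -/
lemma dyadicCap_eq_of_admissible {K : Set ℂ} (hKc : IsCompact K) (hK : BergmanAdmissible K)
    {n k : ℕ} (hk : k < 2 ^ n) : dyadicCap (circleExp ⁻¹' K) n k = n / 2 ^ n := by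
  by_contra hne
  have hT : IsClosed (circleExp ⁻¹' K) := hKc.isClosed.preimage continuous_circleExp
  have hlt := lt_of_le_of_ne (dyadicCap_le (circleExp ⁻¹' K) n k) hne
  obtain ⟨Z, w, hZT, hZ, hv, -, hfin, h⟩ := exists_finite_entropy hT hlt
  have hn : n ≠ 0 := by
    rintro rfl
    have := dyadicCap_nonneg (circleExp ⁻¹' K) 0 k
    simp at hlt
    linarith
  have hZne : Z.Nonempty := nonempty_of_measure_ne_zero hv
  have hb : ((k : ℝ) + 1) / 2 ^ n ≤ 1 := by
    rw [div_le_one (by positivity)]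
    exact_mod_cast hk
  refine hK.not_satisfiesCarleson ?_ ?_ ?_ (satisfiesCarleson_of_gaps hn hk hZ hZne hfin h)
  · rw [image_subset_iff]
    exact closure_minimal hZT hT
  · refine IsCompact.image ?_ continuous_circleExp
    exact isCompact_Icc.of_isClosed_subset isClosed_closure
      (closure_minimal (hZ.trans Ico_subset_Icc_self) isClosed_Icc)
  · refine arcMeasure_ne_zero_of_circleExp (fun t ht => ⟨?_, ?_⟩)
      (fun t ht => ⟨t, subset_closure ht, rfl⟩) hv
    · exact le_trans (by positivity) (hZ ht).1
    · exact (hZ ht).2.trans_le hb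

lemma biUnion_dyadicIco (n : ℕ) : ⋃ k ∈ Finset.range (2 ^ n), dyadicIco n k = Ico (0 : ℝ) 1 := by
  have h2 : (0 : ℝ) < 2 ^ n := by positivity
  ext t
  simp only [mem_iUnion, Finset.mem_range, exists_prop, mem_Ico]
  constructor
  · rintro ⟨k, hk, ht⟩
    refine ⟨le_trans (by positivity) ht.1, ht.2.trans_le ?_⟩
    rw [div_le_one h2]
    exact_mod_cast hk
  · rintro ⟨h0, h1⟩
    obtain ⟨k, hk⟩ := exists_mem_dyadicIco n h0
    refine ⟨k, ?_, hk⟩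
    have : (k : ℝ) < 2 ^ n := (mem_dyadicIco.1 hk).1.trans_lt (by nlinarith)
    exact_mod_cast this

lemma dyadicIco_subset_Ico {n k : ℕ} (hk : k < 2 ^ n) : dyadicIco n k ⊆ Ico 0 1 := by
  rw [← biUnion_dyadicIco n]
  exact subset_biUnion_of_mem (u := fun k => dyadicIco n k) (by simpa using hk)

lemma setIntegral_Ico_eq_sum_dyadicIco {E : Type*} [NormedAddCommGroup E] [NormedSpace ℝ E]
    {f : ℝ → E} (hf : IntegrableOn f (Ico 0 1)) (n : ℕ) :
    ∫ t in Ico (0 : ℝ) 1, f t = ∑ k ∈ Finset.range (2 ^ n), ∫ t in dyadicIco n k, f t := by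
  rw [← biUnion_dyadicIco n]
  refine integral_biUnion_finset _ (fun k _ => measurableSet_dyadicIco n k)
    (fun k _ l _ hkl => dyadicIco_disjoint hkl) fun k hk => hf.mono_set ?_
  exact dyadicIco_subset_Ico (by simpa using hk)

/-- A bounded density on `[0, 1)` whose mass is equidistributed at generation `m`, bounded by
`n / 2 ^ n` on finer intervals, and supported away from `K`. -/
structure IsSpreadDensity (K : Set ℂ) (m : ℕ) (M δ : ℝ) (s : ℝ → ℝ) : Prop where
  measurable : Measurable s
  nonneg : ∀ t, 0 ≤ s t
  le : ∀ t, s t ≤ M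
  integral_eq : ∀ k < 2 ^ m, ∫ t in dyadicIco m k, s t = m / 2 / 2 ^ m
  integral_le : ∀ n ≥ m, ∀ l, ∫ t in dyadicIco n l, s t ≤ n / 2 ^ n
  pos : 0 < δ
  le_norm_sub : ∀ t, s t ≠ 0 → ∀ ζ ∈ K, δ ≤ ‖circleExp t - ζ‖

lemma exists_isSpreadDensity {K : Set ℂ} (hKc : IsCompact K) (hK : BergmanAdmissible K) {m : ℕ}
    (hm : m ≠ 0) : ∃ M δ s, IsSpreadDensity K m M δ s := by
  set T := circleExp ⁻¹' K with hTdef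
  have hev : ∀ᶠ j in atTop, ∀ k ∈ Finset.range (2 ^ m),
      (m : ℝ) / 2 / 2 ^ m ≤ dyadicFlow T j m k := by
    refine (Finset.eventually_all _).2 fun k hk => ?_
    have hlt : (m : ℝ) / 2 / 2 ^ m < dyadicCap T m k := by
      rw [dyadicCap_eq_of_admissible hKc hK (Finset.mem_range.1 hk)]
      have : (0 : ℝ) < m := by positivity
      gcongr
      linarith
    exact ((tendsto_dyadicFlow T m k).eventually_const_lt hlt).mono fun _ => le_of_lt
  obtain ⟨j, hj⟩ := hev.exists
  have hex : ∀ k : ℕ, ∃ s : ℝ → ℝ, k < 2 ^ m → (Measurable s ∧ (∀ t, 0 ≤ s t) ∧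
      (∀ t, s t ≤ (m + j : ℕ)) ∧ (∀ t, t ∉ dyadicIco m k → s t = 0) ∧
      (∀ l, ¬ DyadicFree T (m + j) l → ∀ t ∈ dyadicIco (m + j) l, s t = 0) ∧
      ∫ t in dyadicIco m k, s t = m / 2 / 2 ^ m ∧
      ∀ n l, m ≤ n → ∫ t in dyadicIco n l, s t ≤ n / 2 ^ n) := by
    intro k
    by_cases hk : k < 2 ^ m
    · obtain ⟨s, hs⟩ := exists_density_of_le_dyadicFlow T j m k
        (x := (m : ℝ) / 2 / 2 ^ m) (by positivity) (hj k (Finset.mem_range.2 hk))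
      exact ⟨s, fun _ => hs⟩
    · exact ⟨0, fun h => absurd h hk⟩
  choose s hs using hex
  set S : ℝ → ℝ := fun t => ∑ k ∈ Finset.range (2 ^ m), s k t with hS
  have hSk : ∀ k < 2 ^ m, ∀ t ∈ dyadicIco m k, S t = s k t := by
    intro k hk t ht
    refine Finset.sum_eq_single_of_mem k (Finset.mem_range.2 hk) fun k' hk' hne => ?_
    exact (hs k' (Finset.mem_range.1 hk')).2.2.2.1 t
      fun h' => hne (dyadicIco_eq_of_mem h' ht)
  have hS0 : ∀ t, t ∉ Ico (0 : ℝ) 1 → S t = 0 := by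
    intro t ht
    refine Finset.sum_eq_zero fun k hk => ?_
    rw [Finset.mem_range] at hk
    exact (hs k hk).2.2.2.1 t fun h' => ht (dyadicIco_subset_Ico hk h')
  have hcases : ∀ t, S t = 0 ∨ ∃ k < 2 ^ m, t ∈ dyadicIco m k ∧ S t = s k t := by
    intro t
    by_cases ht : t ∈ Ico (0 : ℝ) 1
    · rw [← biUnion_dyadicIco m] at ht
      simp only [mem_iUnion, Finset.mem_range, exists_prop] at ht
      obtain ⟨k, hk, htk⟩ := ht
      exact Or.inr ⟨k, hk, htk, hSk k hk t htk⟩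
    · exact Or.inl (hS0 t ht)
  set F : Set ℂ := ⋃ l ∈ {l | l ∈ Finset.range (2 ^ (m + j)) ∧ DyadicFree T (m + j) l},
    circleExp '' Icc ((l : ℝ) / 2 ^ (m + j)) ((l + 1) / 2 ^ (m + j)) with hF
  have hFc : IsCompact F := by
    refine Set.Finite.isCompact_biUnion ?_ fun l _ => isCompact_Icc.image continuous_circleExp
    exact (Finset.finite_toSet _).subset fun l hl => hl.1
  have hFK : Disjoint F K := by
    rw [Set.disjoint_left]
    intro x hx hxK
    simp only [hF, mem_iUnion] at hx
    obtain ⟨l, ⟨-, hl⟩, t, ht, rfl⟩ := hx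
    exact Set.disjoint_left.1 hl ht hxK
  obtain ⟨δ, hδ, hδF⟩ := exists_pos_forall_lt_edist hFc hKc.isClosed hFK
  refine ⟨(m + j : ℕ), δ, S, ?_, ?_, ?_, ?_, ?_, hδ, ?_⟩
  · exact Finset.measurable_sum _ fun k hk => (hs k (Finset.mem_range.1 hk)).1
  · exact fun t => Finset.sum_nonneg fun k hk => (hs k (Finset.mem_range.1 hk)).2.1 t
  · intro t
    rcases hcases t with h | ⟨k, hk, -, h⟩
    · rw [h]; positivity
    · rw [h]; exact (hs k hk).2.2.1 t
  · intro k hk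
    rw [setIntegral_congr_fun (measurableSet_dyadicIco m k) (hSk k hk)]
    exact (hs k hk).2.2.2.2.2.1
  · intro n hn l
    have hmem : (l : ℝ) / 2 ^ n ∈ dyadicIco n l := ⟨le_rfl, by gcongr; linarith⟩
    obtain ⟨k, hk⟩ := exists_mem_dyadicIco m (t := (l : ℝ) / 2 ^ n) (by positivity)
    have hsub := dyadicIco_subset_of_mem hn hk hmem
    by_cases hk' : k < 2 ^ m
    · rw [setIntegral_congr_fun (measurableSet_dyadicIco n l)
        fun t ht => hSk k hk' t (hsub ht)]
      exact (hs k hk').2.2.2.2.2.2 n l hn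
    · rw [setIntegral_congr_fun (g := fun _ => (0 : ℝ)) (measurableSet_dyadicIco n l)
        fun t ht => ?_]
      · simp only [integral_zero]; positivity
      · refine Finset.sum_eq_zero fun k' hk'' => ?_
        rw [Finset.mem_range] at hk''
        exact (hs k' hk'').2.2.2.1 t fun h' => hk' (dyadicIco_eq_of_mem h' (hsub ht) ▸ hk'')
  · intro t ht ζ hζ
    obtain ⟨k, hk, htk, h⟩ := (hcases t).resolve_left ht
    rw [h] at ht
    have h01 := dyadicIco_subset_Ico hk htk
    rw [← biUnion_dyadicIco (m + j)] at h01
    simp only [mem_iUnion, exists_prop] at h01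
    obtain ⟨l, hl, htl⟩ := h01
    have hfree : DyadicFree T (m + j) l := by
      by_contra hc
      exact ht ((hs k hk).2.2.2.2.1 l hc t htl)
    have hmF : circleExp t ∈ F :=
      mem_biUnion (x := l) ⟨hl, hfree⟩ ⟨t, Ico_subset_Icc_self htl, rfl⟩
    have := hδF _ hmF ζ hζ
    rw [edist_nndist, ENNReal.coe_lt_coe] at this
    rw [← dist_eq_norm]
    exact_mod_cast this.le

lemma norm_circleExp_sub_le (s t : ℝ) :
    ‖circleExp s - circleExp t‖ ≤ 2 * Real.pi * |s - t| := by
  have h : circleExp s - circleExp t =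
      circleExp t * (Complex.exp (Complex.I * (2 * Real.pi * (s - t) : ℝ)) - 1) := by
    rw [mul_sub, mul_one, circleExp, circleExp, ← Complex.exp_add]
    congr 2
    push_cast
    ring
  rw [h, norm_mul, norm_circleExp, one_mul]
  refine (Real.norm_exp_I_mul_ofReal_sub_one_le).trans_eq ?_
  rw [Real.norm_eq_abs, abs_mul, abs_of_pos (by positivity)]

lemma one_sub_norm_le_norm_circleExp_sub (t : ℝ) (z : ℂ) : 1 - ‖z‖ ≤ ‖circleExp t - z‖ := by
  have := norm_sub_norm_le (circleExp t) z
  rwa [norm_circleExp] at this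

lemma circleExp_sub_ne_zero {z : ℂ} (hz : ‖z‖ < 1) (t : ℝ) : circleExp t - z ≠ 0 := by
  rw [← norm_pos_iff]
  linarith [one_sub_norm_le_norm_circleExp_sub t z]

/-- The Herglotz kernel on the circle parametrised by `[0, 1)`. -/
def herglotz (z : ℂ) (t : ℝ) : ℂ := (circleExp t + z) / (circleExp t - z)

lemma continuous_herglotz {z : ℂ} (hz : ‖z‖ < 1) : Continuous (herglotz z) :=
  (continuous_circleExp.add continuous_const).div (continuous_circleExp.sub continuous_const)
    (circleExp_sub_ne_zero hz)

lemma norm_herglotz_sub_le {z : ℂ} (hz : ‖z‖ < 1) (s t : ℝ) :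
    ‖herglotz z s - herglotz z t‖ ≤ 4 * Real.pi * |s - t| / (1 - ‖z‖) ^ 2 := by
  have h2 : 0 < 1 - ‖z‖ := by linarith
  have hs := circleExp_sub_ne_zero hz s
  have ht := circleExp_sub_ne_zero hz t
  have h : herglotz z s - herglotz z t =
      2 * z * (circleExp t - circleExp s) / ((circleExp s - z) * (circleExp t - z)) := by
    rw [herglotz, herglotz]
    field_simp
    ring
  rw [h, norm_div, norm_mul, norm_mul, norm_mul, Complex.norm_ofNat, norm_sub_rev (circleExp t),
    sq]
  have h3 := norm_circleExp_sub_le s t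
  have h4 := one_sub_norm_le_norm_circleExp_sub s z
  have h5 := one_sub_norm_le_norm_circleExp_sub t z
  have h6 : 2 * ‖z‖ * ‖circleExp s - circleExp t‖ ≤ 4 * Real.pi * |s - t| := by
    calc 2 * ‖z‖ * ‖circleExp s - circleExp t‖ ≤ 2 * 1 * (2 * Real.pi * |s - t|) := by gcongr
      _ = _ := by ring
  have : 0 ≤ 4 * Real.pi * |s - t| := by positivity
  gcongr

lemma re_herglotz (z : ℂ) (t : ℝ) :
    (herglotz z t).re = (1 - ‖z‖ ^ 2) / ‖circleExp t - z‖ ^ 2 := by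
  have := congrFun (poissonKernel_eq_re_herglotzRieszKernel (c := 0) (w := z)) (circleExp t)
  simp only [poissonKernel, herglotzRieszKernel, Function.comp, sub_zero, norm_circleExp,
    one_pow] at this
  rw [herglotz, ← this]

lemma re_herglotz_nonneg {z : ℂ} (hz : ‖z‖ < 1) (t : ℝ) : 0 ≤ (herglotz z t).re := by
  rw [re_herglotz]
  have : ‖z‖ ^ 2 ≤ 1 := by nlinarith [norm_nonneg z]
  have : 0 ≤ 1 - ‖z‖ ^ 2 := by linarith
  positivity

/-- Harnack's inequality at the scale of the distance to the circle. -/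
lemma re_herglotz_le_mul {z : ℂ} (hz : ‖z‖ < 1) {s t : ℝ} (hst : |s - t| ≤ 1 - ‖z‖) :
    (herglotz z s).re ≤ (1 + 2 * Real.pi) ^ 2 * (herglotz z t).re := by
  rw [re_herglotz, re_herglotz]
  have hs : 0 < ‖circleExp s - z‖ := norm_pos_iff.2 (circleExp_sub_ne_zero hz s)
  have ht : 0 < ‖circleExp t - z‖ := norm_pos_iff.2 (circleExp_sub_ne_zero hz t)
  have h4 := one_sub_norm_le_norm_circleExp_sub s z
  have h1 : ‖circleExp t - z‖ ≤ (1 + 2 * Real.pi) * ‖circleExp s - z‖ := by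
    have h2 := norm_sub_le_norm_sub_add_norm_sub (circleExp t) (circleExp s) z
    have h3 := norm_circleExp_sub_le t s
    rw [abs_sub_comm] at h3
    have : 2 * Real.pi * |s - t| ≤ 2 * Real.pi * ‖circleExp s - z‖ := by
      gcongr
      linarith
    linarith
  have h0 : 0 ≤ 1 - ‖z‖ ^ 2 := by nlinarith [norm_nonneg z]
  rw [← mul_div_assoc, div_le_div_iff₀ (by positivity) (by positivity)]
  calc (1 - ‖z‖ ^ 2) * ‖circleExp t - z‖ ^ 2
      ≤ (1 - ‖z‖ ^ 2) * ((1 + 2 * Real.pi) * ‖circleExp s - z‖) ^ 2 := by gcongr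
    _ = _ := by ring

lemma integral_herglotz {z : ℂ} (hz : ‖z‖ < 1) : ∫ t in Ico (0 : ℝ) 1, herglotz z t = 1 := by
  have h1 := DiffContOnCl.circleAverage_smul_div (f := fun _ => (1 : ℂ)) (c := 0) (R := 1) (w := z)
    diffContOnCl_const (by simpa using hz)
  rw [Real.circleAverage_def] at h1
  have h2 : (∫ t in (0 : ℝ)..1, circleExp t / (circleExp t - z)) = 1 := by
    have h3 := intervalIntegral.integral_comp_mul_left (a := 0) (b := 1)
      (fun θ : ℝ => ((circleMap 0 1 θ - 0) / (circleMap 0 1 θ - z)) • (1 : ℂ))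
      (show 2 * Real.pi ≠ 0 by positivity)
    rw [mul_zero, mul_one, h1] at h3
    rw [← h3]
    refine intervalIntegral.integral_congr fun t _ => ?_
    simp [circleMap, circleExp]
  have hc : Continuous fun t => circleExp t / (circleExp t - z) :=
    continuous_circleExp.div (continuous_circleExp.sub continuous_const)
      (circleExp_sub_ne_zero hz)
  have h4 : ∀ t, herglotz z t = 2 * (circleExp t / (circleExp t - z)) - 1 := by
    intro t
    have := circleExp_sub_ne_zero hz t
    rw [herglotz]
    field_simp
    ring
  rw [integral_Ico_eq_integral_Ioc, ← intervalIntegral.integral_of_le zero_le_one]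
  simp only [h4]
  rw [intervalIntegral.integral_sub ((hc.const_mul _).intervalIntegrable _ _) (by simp),
    intervalIntegral.integral_const_mul, h2]
  simp
  norm_num

lemma integrableOn_herglotz {z : ℂ} (hz : ‖z‖ < 1) : IntegrableOn (herglotz z) (Ico 0 1) :=
  ((continuous_herglotz hz).integrableOn_Icc (a := 0) (b := 1)).mono_set Ico_subset_Icc_self

lemma integrable_mul_herglotz {s : ℝ → ℝ} (hs : Measurable s) {M : ℝ} (h0 : ∀ t, 0 ≤ s t)
    (hM : ∀ t, s t ≤ M) {z : ℂ} (hz : ‖z‖ < 1) :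
    IntegrableOn (fun t => (s t : ℂ) * herglotz z t) (Ico 0 1) := by
  refine (integrableOn_herglotz hz).bdd_mul (c := M) (by fun_prop) ?_
  exact Eventually.of_forall fun t => by
    rw [Complex.norm_real, Real.norm_of_nonneg (h0 t)]; exact hM t

/-- The Herglotz integral of a density on `[0, 1)`. -/
def herglotzIntegral (s : ℝ → ℝ) (z : ℂ) : ℂ := ∫ t in Ico (0 : ℝ) 1, (s t : ℂ) * herglotz z t

lemma differentiableOn_herglotzIntegral {s : ℝ → ℝ} (hs : Measurable s) {M : ℝ}
    (h0 : ∀ t, 0 ≤ s t) (hM : ∀ t, s t ≤ M) :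
    DifferentiableOn ℂ (herglotzIntegral s) (ball 0 1) := by
  intro w hw
  rw [mem_ball_zero_iff] at hw
  set R := (1 + ‖w‖) / 2 with hR
  have hR1 : R < 1 := by rw [hR]; linarith
  have hwR : ‖w‖ < R := by rw [hR]; linarith
  have hM0 : 0 ≤ M := (h0 0).trans (hM 0)
  have hmem : ball (0 : ℂ) R ∈ 𝓝 w := isOpen_ball.mem_nhds (by simpa using hwR)
  have hd : ∀ t : ℝ, ∀ z ∈ ball (0 : ℂ) R, HasDerivAt (fun z => (s t : ℂ) * herglotz z t)
      ((s t : ℂ) * (2 * circleExp t / (circleExp t - z) ^ 2)) z := by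
    intro t z hz
    have hz1 : ‖z‖ < 1 := by rw [mem_ball_zero_iff] at hz; linarith
    have hne := circleExp_sub_ne_zero hz1 t
    have h1 : HasDerivAt (fun z => herglotz z t)
        ((1 * (circleExp t - z) - (circleExp t + z) * (-1)) / (circleExp t - z) ^ 2) z :=
      ((hasDerivAt_id z).const_add _).div ((hasDerivAt_id z).const_sub _) hne
    rw [show 1 * (circleExp t - z) - (circleExp t + z) * (-1) = 2 * circleExp t by ring] at h1
    exact h1.const_mul (s t : ℂ)
  have hcirc := continuous_circleExp
  refine (hasDerivAt_integral_of_dominated_loc_of_deriv_le (bound := fun _ => M * (2 / (1 - R) ^ 2))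
    (F := fun z t => (s t : ℂ) * herglotz z t) hmem ?_ (integrable_mul_herglotz hs h0 hM hw) ?_ ?_
    ?_ (Eventually.of_forall hd)).2.differentiableAt.differentiableWithinAt
  · filter_upwards [hmem] with z hz
    have hz1 : ‖z‖ < 1 := by rw [mem_ball_zero_iff] at hz; linarith
    exact (integrable_mul_herglotz hs h0 hM hz1).aestronglyMeasurable
  · refine Measurable.aestronglyMeasurable ?_
    have := hcirc.measurable
    fun_prop
  · refine Eventually.of_forall fun t z hz => ?_
    rw [mem_ball_zero_iff] at hz
    rw [norm_mul, Complex.norm_real, Real.norm_of_nonneg (h0 t), norm_div, norm_mul, norm_circleExp,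
      Complex.norm_ofNat, norm_pow, mul_one]
    have := one_sub_norm_le_norm_circleExp_sub t z
    have hR' : 0 < 1 - R := by linarith
    have : 1 - R ≤ ‖circleExp t - z‖ := by linarith
    gcongr
    exact hM t
  · exact integrable_const _

lemma re_herglotzIntegral {s : ℝ → ℝ} (hs : Measurable s) {M : ℝ}
    (h0 : ∀ t, 0 ≤ s t) (hM : ∀ t, s t ≤ M) {z : ℂ} (hz : ‖z‖ < 1) :
    (herglotzIntegral s z).re = ∫ t in Ico (0 : ℝ) 1, s t * (herglotz z t).re := by
  rw [herglotzIntegral, ← Complex.reCLM_apply, ← ContinuousLinearMap.integral_comp_comm _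
    (integrable_mul_herglotz hs h0 hM hz)]
  simp

namespace IsSpreadDensity

variable {K : Set ℂ} {m : ℕ} {M δ : ℝ} {s : ℝ → ℝ}

lemma bound_nonneg (hs : IsSpreadDensity K m M δ s) : 0 ≤ M := (hs.nonneg 0).trans (hs.le 0)

lemma integrableOn (hs : IsSpreadDensity K m M δ s) (n k : ℕ) : IntegrableOn s (dyadicIco n k) :=
  integrableOn_dyadicIco_of_bdd hs.measurable hs.nonneg hs.le n k

lemma norm_setIntegral_le (hs : IsSpreadDensity K m M δ s) {z : ℂ} (hz : ‖z‖ < 1) {k : ℕ}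
    (hk : k < 2 ^ m) :
    ‖∫ t in dyadicIco m k, ((s t - m / 2 : ℝ) : ℂ) * herglotz z t‖ ≤
      m / 2 ^ m * (4 * Real.pi * (1 / 2 ^ m) / (1 - ‖z‖) ^ 2) := by
  have hsub := dyadicIco_subset_Ico hk
  have hJ := measurableSet_dyadicIco m k
  have hfin : volume (dyadicIco m k) ≠ ⊤ := volume_dyadicIco_ne_top m k
  have hd : 0 < 1 - ‖z‖ := by linarith
  set B := 4 * Real.pi * (1 / 2 ^ m) / (1 - ‖z‖) ^ 2 with hB
  set t₀ : ℝ := (k : ℝ) / 2 ^ m with ht₀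
  have hc : IntegrableOn (fun _ : ℝ => (m : ℝ) / 2) (dyadicIco m k) := integrableOn_const hfin
  have h1 : IntegrableOn (fun t => s t - (m : ℝ) / 2) (dyadicIco m k) :=
    (hs.integrableOn m k).sub hc
  have hmean : ∫ t in dyadicIco m k, (s t - (m : ℝ) / 2) = 0 := by
    rw [integral_sub (hs.integrableOn m k) hc, hs.integral_eq k hk, setIntegral_const,
      volume_real_dyadicIco, smul_eq_mul]
    ring
  have h2 : IntegrableOn (fun t => ((s t - m / 2 : ℝ) : ℂ) * herglotz z t) (dyadicIco m k) := by
    have h3 := (integrable_mul_herglotz hs.measurable hs.nonneg hs.le hz).mono_set hsub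
    have h4 := ((integrableOn_herglotz hz).mono_set hsub).const_mul ((m / 2 : ℝ) : ℂ)
    refine (h3.sub h4).congr (Eventually.of_forall fun t => ?_)
    simp only [Pi.sub_apply]
    push_cast
    ring
  have h5 : IntegrableOn (fun t => ((s t - m / 2 : ℝ) : ℂ) * herglotz z t₀) (dyadicIco m k) :=
    h1.ofReal.mul_const _
  have h6 : ∫ t in dyadicIco m k, ((s t - m / 2 : ℝ) : ℂ) * herglotz z t =
      ∫ t in dyadicIco m k, (((s t - m / 2 : ℝ) : ℂ) * herglotz z t -
        ((s t - m / 2 : ℝ) : ℂ) * herglotz z t₀) := by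
    rw [integral_sub h2 h5, integral_mul_const, integral_complex_ofReal, hmean]
    simp
  rw [h6]
  have hsum : IntegrableOn (fun t => (s t + (m : ℝ) / 2) * B) (dyadicIco m k) :=
    ((hs.integrableOn m k).add hc).mul_const _
  have h7 : ∫ t in dyadicIco m k, (s t + (m : ℝ) / 2) * B = m / 2 ^ m * B := by
    rw [integral_mul_const, integral_add (hs.integrableOn m k) hc, hs.integral_eq k hk,
      setIntegral_const, volume_real_dyadicIco, smul_eq_mul]
    ring
  rw [← h7]
  refine norm_integral_le_of_norm_le hsum ?_
  rw [ae_restrict_iff' hJ]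
  refine Eventually.of_forall fun t ht => ?_
  rw [← mul_sub, norm_mul, Complex.norm_real]
  have h8 : ‖s t - (m : ℝ) / 2‖ ≤ s t + m / 2 := by
    refine (norm_sub_le _ _).trans_eq ?_
    rw [Real.norm_of_nonneg (hs.nonneg t), Real.norm_of_nonneg (by positivity)]
  have h9 : |t - t₀| ≤ 1 / 2 ^ m := by
    rw [dyadicIco] at ht
    rw [abs_of_nonneg (by linarith [ht.1])]
    have := ht.2
    rw [add_div] at this
    linarith
  have h10 : ‖herglotz z t - herglotz z t₀‖ ≤ B := by
    refine (norm_herglotz_sub_le hz t t₀).trans ?_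
    rw [hB]
    gcongr
  have := hs.nonneg t
  gcongr

/-- The oscillation estimate: up to scale `2 ^ (-m)` the density looks like the constant `m / 2`. -/
lemma norm_herglotzIntegral_sub_le (hs : IsSpreadDensity K m M δ s) {z : ℂ} (hz : ‖z‖ < 1) :
    ‖herglotzIntegral s z - m / 2‖ ≤ 4 * Real.pi * m / 2 ^ m / (1 - ‖z‖) ^ 2 := by
  have h3 := integrable_mul_herglotz hs.measurable hs.nonneg hs.le hz
  have h4 := (integrableOn_herglotz hz).const_mul ((m / 2 : ℝ) : ℂ)
  have h1 : herglotzIntegral s z - m / 2 =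
      ∫ t in Ico (0 : ℝ) 1, ((s t - m / 2 : ℝ) : ℂ) * herglotz z t := by
    have : ∀ t, ((s t - m / 2 : ℝ) : ℂ) * herglotz z t =
        (s t : ℂ) * herglotz z t - ((m / 2 : ℝ) : ℂ) * herglotz z t := by
      intro t
      push_cast
      ring
    simp only [this]
    rw [integral_sub h3 h4, integral_const_mul, integral_herglotz hz, herglotzIntegral]
    push_cast
    ring
  have h2 : IntegrableOn (fun t => ((s t - m / 2 : ℝ) : ℂ) * herglotz z t) (Ico 0 1) := by
    refine (h3.sub h4).congr (Eventually.of_forall fun t => ?_)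
    simp only [Pi.sub_apply]
    push_cast
    ring
  rw [h1, setIntegral_Ico_eq_sum_dyadicIco h2 m]
  refine (norm_sum_le_of_le _ fun k hk =>
    hs.norm_setIntegral_le hz (Finset.mem_range.1 hk)).trans_eq ?_
  rw [Finset.sum_const, Finset.card_range, nsmul_eq_mul]
  push_cast
  field_simp

/-- At scale `2 ^ (-n)` the Poisson integral of the density is controlled by `n`. -/
lemma re_herglotzIntegral_le (hs : IsSpreadDensity K m M δ s) {z : ℂ} (hz : ‖z‖ < 1) {n : ℕ}
    (hmn : m ≤ n) (hn : 1 / 2 ^ n ≤ 1 - ‖z‖) :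
    (herglotzIntegral s z).re ≤ (1 + 2 * Real.pi) ^ 4 * n := by
  have hd : 0 < 1 - ‖z‖ := by linarith
  have hPc : Continuous fun t => (herglotz z t).re :=
    Complex.continuous_re.comp (continuous_herglotz hz)
  have hP : IntegrableOn (fun t => (herglotz z t).re) (Ico 0 1) := (integrableOn_herglotz hz).re
  have hsP : IntegrableOn (fun t => s t * (herglotz z t).re) (Ico 0 1) := by
    refine ((integrable_mul_herglotz hs.measurable hs.nonneg hs.le hz).re).congr
      (Eventually.of_forall fun t => ?_)
    simp
  have hone : ∫ t in Ico (0 : ℝ) 1, (herglotz z t).re = 1 := by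
    have := integral_re (integrableOn_herglotz hz)
    rw [integral_herglotz hz] at this
    simpa using this
  set A := (1 + 2 * Real.pi) ^ 2 with hA
  rw [re_herglotzIntegral hs.measurable hs.nonneg hs.le hz, setIntegral_Ico_eq_sum_dyadicIco hsP n]
  have hkey : ∀ k ∈ Finset.range (2 ^ n), ∫ t in dyadicIco n k, s t * (herglotz z t).re ≤
      A ^ 2 * n * ∫ t in dyadicIco n k, (herglotz z t).re := by
    intro k hk
    have hsub := dyadicIco_subset_Ico (Finset.mem_range.1 hk)
    have hJ := measurableSet_dyadicIco n k
    set t₀ : ℝ := (k : ℝ) / 2 ^ n with ht₀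
    set P₀ := (herglotz z t₀).re with hP₀
    have hP₀0 : 0 ≤ P₀ := re_herglotz_nonneg hz t₀
    have hdist : ∀ t ∈ dyadicIco n k, |t - t₀| ≤ 1 - ‖z‖ := by
      intro t ht
      refine le_trans ?_ hn
      rw [dyadicIco] at ht
      rw [abs_of_nonneg (by linarith [ht.1])]
      have := ht.2
      rw [add_div] at this
      linarith
    have h1 : ∫ t in dyadicIco n k, s t * (herglotz z t).re ≤
        ∫ t in dyadicIco n k, s t * (A * P₀) := by
      refine setIntegral_mono_on (hsP.mono_set hsub) ((hs.integrableOn n k).mul_const _) hJ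
        fun t ht => ?_
      exact mul_le_mul_of_nonneg_left (re_herglotz_le_mul hz (hdist t ht)) (hs.nonneg t)
    have h2 : P₀ * (1 / 2 ^ n) ≤ A * ∫ t in dyadicIco n k, (herglotz z t).re := by
      have h3 : ∫ _ in dyadicIco n k, P₀ ≤ ∫ t in dyadicIco n k, A * (herglotz z t).re := by
        refine setIntegral_mono_on (integrableOn_const (volume_dyadicIco_ne_top n k))
          ((hP.mono_set hsub).const_mul _) hJ fun t ht => ?_
        exact re_herglotz_le_mul hz (by rw [abs_sub_comm]; exact hdist t ht)
      rwa [setIntegral_const, volume_real_dyadicIco, smul_eq_mul, integral_const_mul,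
        mul_comm] at h3
    rw [integral_mul_const] at h1
    calc _ ≤ _ := h1
      _ ≤ n / 2 ^ n * (A * P₀) := by
        gcongr
        exact hs.integral_le n hmn k
      _ = A * n * (P₀ * (1 / 2 ^ n)) := by ring
      _ ≤ A * n * (A * ∫ t in dyadicIco n k, (herglotz z t).re) := by gcongr
      _ = _ := by ring
  refine (Finset.sum_le_sum hkey).trans_eq ?_
  rw [← Finset.mul_sum, ← setIntegral_Ico_eq_sum_dyadicIco hP n, hone, hA]
  ring

lemma re_herglotzIntegral_le_of_mem (hs : IsSpreadDensity K m M δ s) {ζ : ℂ} (hζK : ζ ∈ K)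
    (hζ : ‖ζ‖ = 1) {r : ℝ} (hr0 : 0 ≤ r) (hr1 : r < 1) (hr : 1 - r ≤ δ / 2) :
    (herglotzIntegral s (r * ζ)).re ≤ M * ((1 - r ^ 2) / (δ / 2) ^ 2) := by
  have hδ := hs.pos
  have hM := hs.bound_nonneg
  have hnorm : ‖(r : ℂ) * ζ‖ = r := by
    rw [norm_mul, hζ, mul_one, Complex.norm_real, Real.norm_of_nonneg hr0]
  have hz : ‖(r : ℂ) * ζ‖ < 1 := by rwa [hnorm]
  have hr2 : 0 ≤ 1 - r ^ 2 := by nlinarith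
  rw [re_herglotzIntegral hs.measurable hs.nonneg hs.le hz]
  have hsP : IntegrableOn (fun t => s t * (herglotz (r * ζ) t).re) (Ico 0 1) := by
    refine ((integrable_mul_herglotz hs.measurable hs.nonneg hs.le hz).re).congr
      (Eventually.of_forall fun t => ?_)
    simp
  have h1 : ∫ t in Ico (0 : ℝ) 1, s t * (herglotz (r * ζ) t).re ≤
      ∫ _ in Ico (0 : ℝ) 1, M * ((1 - r ^ 2) / (δ / 2) ^ 2) := by
    refine setIntegral_mono hsP (integrableOn_const (by simp)) fun t => ?_
    by_cases ht : s t = 0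
    · simp only [ht, zero_mul]
      positivity
    · have h2 := hs.le_norm_sub t ht ζ hζK
      have h3 : ‖ζ - r * ζ‖ = 1 - r := by
        rw [show ζ - r * ζ = ((1 - r : ℝ) : ℂ) * ζ by push_cast; ring, norm_mul, hζ, mul_one,
          Complex.norm_real, Real.norm_of_nonneg (by linarith)]
      have h4 : δ / 2 ≤ ‖circleExp t - r * ζ‖ := by
        have h5 := norm_sub_le_norm_sub_add_norm_sub (circleExp t) (r * ζ) ζ
        rw [norm_sub_rev (_ * ζ)] at h5
        linarith
      have h6 := hs.nonneg t
      simp only [re_herglotz, hnorm]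
      gcongr
      exact hs.le t
  simpa using h1

end IsSpreadDensity

lemma one_le_one_sub_norm_rpow_neg {z : ℂ} (hz : ‖z‖ < 1) {a : ℝ} (ha : 0 ≤ a) :
    1 ≤ (1 - ‖z‖) ^ (-a) :=
  Real.one_le_rpow_of_pos_of_le_one_of_nonpos (by linarith) (by linarith [norm_nonneg z])
    (by linarith)

/-- A holomorphic function of small weighted sup norm that is close to `1` on `K`. -/
lemma exists_differentiableOn_near_one {K : Set ℂ} (hKc : IsCompact K)
    (hKT : K ⊆ sphere (0 : ℂ) 1) (hK : BergmanAdmissible K) {a : ℝ} (ha : 0 < a) {ε : ℝ}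
    (hε : 0 < ε) :
    ∃ (h : ℂ → ℂ) (R : ℝ), 1 < R ∧ DifferentiableOn ℂ h (ball 0 R) ∧
      (∀ z ∈ ball (0 : ℂ) 1, ‖h z‖ ≤ ε * (1 - ‖z‖) ^ (-a)) ∧ ∀ ζ ∈ K, ‖h ζ - 1‖ ≤ ε := by
  have hl2 : 0 < Real.log 2 := Real.log_pos one_lt_two
  set D : ℝ := (1 + 2 * Real.pi) ^ 4 with hD
  have hD0 : 0 < D := by positivity
  set c : ℝ := a * Real.log 2 / (8 * D) with hc
  have hc0 : 0 < c := by positivity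
  have hcD : c * D = a * Real.log 2 / 8 := by rw [hc]; field_simp
  have hev : ∀ᶠ q : ℕ in atTop, c * (16 * Real.pi * (q / 4 ^ q)) ≤ min 1 (ε / 2) ∧
      2 * Real.exp (-(a * Real.log 2 / 2 * q)) ≤ ε ∧ Real.exp (c * (1 - 2 * q)) ≤ ε ∧ 1 ≤ q := by
    have hcast : Tendsto (fun q : ℕ => (q : ℝ)) atTop atTop := tendsto_natCast_atTop_atTop
    refine Eventually.and ?_ (Eventually.and ?_ (Eventually.and ?_ (eventually_ge_atTop 1)))
    · have h1 : Tendsto (fun q : ℕ => (q : ℝ) * (1 / 4) ^ q) atTop (𝓝 0) :=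
        tendsto_self_mul_const_pow_of_lt_one (by norm_num) (by norm_num)
      have h2 : Tendsto (fun q : ℕ => c * (16 * Real.pi * (q / 4 ^ q))) atTop (𝓝 0) := by
        have h3 := (h1.const_mul (16 * Real.pi)).const_mul c
        simpa [div_eq_mul_inv] using h3
      exact h2.eventually_le_const (lt_min one_pos (by positivity))
    · have h2 : Tendsto (fun q : ℕ => 2 * Real.exp (-(a * Real.log 2 / 2 * q))) atTop
          (𝓝 (2 * 0)) :=
        (Real.tendsto_exp_neg_atTop_nhds_zero.comp
          (hcast.const_mul_atTop (by positivity : 0 < a * Real.log 2 / 2))).const_mul 2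
      exact h2.eventually_le_const (by simpa using hε)
    · have h3 : Tendsto (fun q : ℕ => c * (1 - 2 * (q : ℝ))) atTop atBot := by
        refine Tendsto.const_mul_atBot hc0 ?_
        exact tendsto_atBot_add_const_left _ 1
          (tendsto_neg_atTop_atBot.comp (hcast.const_mul_atTop two_pos))
      exact (Real.tendsto_exp_atBot.comp h3).eventually_le_const hε
  obtain ⟨q, hq1, hq2, hq3, hq⟩ := hev.exists
  obtain ⟨M, δ, s, hs⟩ := exists_isSpreadDensity hKc hK (m := 4 * q) (by omega)
  have hV := differentiableOn_herglotzIntegral hs.measurable hs.nonneg hs.le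
  set v : ℂ → ℂ := fun z => c * (herglotzIntegral s z - 2 * q) with hv
  set h : ℂ → ℂ := fun z => 1 - Complex.exp (v z) with hh
  have hhd : DifferentiableOn ℂ h (ball 0 1) := by
    have : DifferentiableOn ℂ v (ball 0 1) := (hV.sub_const _).const_mul _
    exact this.cexp.const_sub 1
  have hre : ∀ z, (v z).re = c * ((herglotzIntegral s z).re - 2 * q) := by
    intro z
    rw [hv, Complex.re_ofReal_mul, Complex.sub_re]
    congr 2
    norm_cast
  have hbound : ∀ z ∈ ball (0 : ℂ) 1, ‖h z‖ ≤ ε * (1 - ‖z‖) ^ (-a) := by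
    intro z hz
    rw [mem_ball_zero_iff] at hz
    have hd0 : 0 < 1 - ‖z‖ := by linarith
    by_cases hzq : (1 / 2 : ℝ) ^ q ≤ 1 - ‖z‖
    · have h1 : ‖v z‖ ≤ c * (16 * Real.pi * (q / 4 ^ q)) := by
        have h2 := hs.norm_herglotzIntegral_sub_le hz
        rw [hv, norm_mul, Complex.norm_real, Real.norm_of_nonneg hc0.le]
        have h3 : herglotzIntegral s z - 2 * q = herglotzIntegral s z - (4 * q : ℕ) / 2 := by
          push_cast
          ring
        rw [h3]
        gcongr
        refine h2.trans ?_
        have h4 : ((1 / 2 : ℝ) ^ q) ^ 2 ≤ (1 - ‖z‖) ^ 2 := by gcongr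
        calc 4 * Real.pi * (4 * q : ℕ) / 2 ^ (4 * q) / (1 - ‖z‖) ^ 2
            ≤ 4 * Real.pi * (4 * q : ℕ) / 2 ^ (4 * q) / ((1 / 2 : ℝ) ^ q) ^ 2 := by gcongr
          _ = _ := by
            have h16 : (2 : ℝ) ^ (4 * q) = 4 ^ q * 4 ^ q := by
              rw [← mul_pow, pow_mul]; norm_num
            have h4q : ((1 / 2 : ℝ) ^ q) ^ 2 = 1 / 4 ^ q := by
              rw [← pow_mul, mul_comm, pow_mul, ← one_div_pow]; norm_num
            rw [h16, h4q]
            push_cast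
            field_simp
            ring
      have h5 := h1.trans hq1
      have h6 := Complex.norm_exp_sub_one_le (h5.trans (min_le_left _ _))
      rw [hh, norm_sub_rev]
      have h7 := one_le_one_sub_norm_rpow_neg hz ha.le
      calc ‖Complex.exp (v z) - 1‖ ≤ 2 * ‖v z‖ := h6
        _ ≤ 2 * (ε / 2) := by
          gcongr
          exact h5.trans (min_le_right _ _)
        _ = ε * 1 := by ring
        _ ≤ _ := by gcongr
    · push Not at hzq
      obtain ⟨k, hk1, hk2⟩ := exists_nat_pow_near_of_lt_one hd0 (by linarith [norm_nonneg z])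
        (show (0 : ℝ) < 1 / 2 by norm_num) (by norm_num)
      have hqk : q ≤ k := by
        have := (pow_lt_pow_iff_right_of_lt_one₀ (by norm_num : (0 : ℝ) < 1 / 2)
          (by norm_num)).1 (hk1.trans hzq)
        omega
      have h1 : (herglotzIntegral s z).re ≤ D * (4 * k : ℕ) := by
        refine hs.re_herglotzIntegral_le hz (by omega) (le_trans ?_ hk1.le)
        rw [← one_div_pow]
        exact pow_le_pow_of_le_one (by norm_num) (by norm_num) (by omega)
      set E : ℝ := Real.exp (a * Real.log 2 / 2 * k) with hE
      have hE1 : 1 ≤ E := Real.one_le_exp (by positivity)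
      have h2 : ‖Complex.exp (v z)‖ ≤ E := by
        rw [Complex.norm_exp, Real.exp_le_exp, hre]
        calc c * ((herglotzIntegral s z).re - 2 * q) ≤ c * (D * (4 * k : ℕ)) := by
              gcongr
              have : (0 : ℝ) ≤ 2 * q := by positivity
              linarith
          _ = c * D * (4 * k : ℕ) := by ring
          _ = _ := by rw [hcD]; push_cast; ring
      have h3 : 2 * E ≤ ε * E ^ 2 := by
        have h4 : 2 * Real.exp (-(a * Real.log 2 / 2 * k)) ≤ ε := by
          refine le_trans ?_ hq2
          gcongr
        rw [Real.exp_neg, ← hE] at h4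
        have hE0 : 0 < E := by positivity
        calc 2 * E = (2 * E⁻¹) * E ^ 2 := by field_simp
          _ ≤ _ := by gcongr
      have h5 : E ^ 2 ≤ (1 - ‖z‖) ^ (-a) := by
        have h6 : E ^ 2 = ((1 / 2 : ℝ) ^ k) ^ (-a) := by
          rw [hE, ← Real.exp_nat_mul, Real.rpow_def_of_pos (by positivity), Real.log_pow,
            one_div, Real.log_inv]
          congr 1
          push_cast
          ring
        rw [h6]
        exact Real.rpow_le_rpow_of_nonpos hd0 hk2 (by linarith)
      calc ‖h z‖ ≤ ‖(1 : ℂ)‖ + ‖Complex.exp (v z)‖ := norm_sub_le _ _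
        _ ≤ E + E := by
          rw [norm_one]
          gcongr
        _ = 2 * E := by ring
        _ ≤ ε * E ^ 2 := h3
        _ ≤ _ := by gcongr
  have hδ := hs.pos
  have hr : ∀ᶠ r : ℝ in 𝓝[<] 1, M * ((1 - r ^ 2) / (δ / 2) ^ 2) ≤ 1 ∧ 1 - r ≤ δ / 2 ∧ 0 < r ∧
      r < 1 := by
    refine Eventually.and ?_ (Eventually.and ?_ (Eventually.and ?_ self_mem_nhdsWithin))
    · have : Tendsto (fun r : ℝ => M * ((1 - r ^ 2) / (δ / 2) ^ 2)) (𝓝[<] 1)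
          (𝓝 (M * ((1 - 1 ^ 2) / (δ / 2) ^ 2))) :=
        ((continuous_const.mul ((continuous_const.sub (continuous_pow 2)).div_const _)).tendsto
          1).mono_left nhdsWithin_le_nhds
      exact this.eventually_le_const (by simp)
    · have : Tendsto (fun r : ℝ => 1 - r) (𝓝[<] 1) (𝓝 (1 - 1)) :=
        ((continuous_const.sub continuous_id).tendsto 1).mono_left nhdsWithin_le_nhds
      exact this.eventually_le_const (by simpa using hδ)
    · exact nhdsWithin_le_nhds (lt_mem_nhds one_pos)
  obtain ⟨r, hr1, hr2, hr0, hr3⟩ := hr.exists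
  refine ⟨fun z => h (r * z), 1 / r, by rwa [lt_div_iff₀ hr0, one_mul], ?_, ?_, ?_⟩
  · refine hhd.comp (by fun_prop) fun z hz => ?_
    rw [mem_ball_zero_iff] at hz ⊢
    rw [norm_mul, Complex.norm_real, Real.norm_of_nonneg hr0.le]
    rwa [lt_div_iff₀ hr0, mul_comm] at hz
  · intro z hz
    rw [mem_ball_zero_iff] at hz
    have hrz : ‖(r : ℂ) * z‖ ≤ ‖z‖ := by
      rw [norm_mul, Complex.norm_real, Real.norm_of_nonneg hr0.le]
      exact mul_le_of_le_one_left (norm_nonneg z) hr3.le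
    refine (hbound _ (by rw [mem_ball_zero_iff]; linarith)).trans ?_
    gcongr ε * ?_
    exact Real.rpow_le_rpow_of_nonpos (by linarith) (by linarith) (by linarith)
  · intro ζ hζ
    have h1 := hs.re_herglotzIntegral_le_of_mem hζ (by simpa using hKT hζ) hr0.le hr3 hr2
    rw [hh]
    simp only [sub_sub_cancel_left, norm_neg]
    rw [Complex.norm_exp, hre]
    refine le_trans ?_ hq3
    gcongr
    exact h1.trans hr1

/-- The continuous function `φ` on `K` can be uniformly approximated by functions, holomorphic on
a neighbourhood of the closed disk, of small weighted sup norm. -/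
def SmallApprox (a : ℝ) (K : Set ℂ) (φ : C(K, ℂ)) : Prop :=
  ∀ ε > 0, ∃ (h : ℂ → ℂ) (R : ℝ), 1 < R ∧ DifferentiableOn ℂ h (ball 0 R) ∧
    (∀ z ∈ ball (0 : ℂ) 1, ‖h z‖ ≤ ε * (1 - ‖z‖) ^ (-a)) ∧ ∀ ζ : K, ‖h ζ - φ ζ‖ ≤ ε

namespace SmallApprox

variable {a : ℝ} {K : Set ℂ} {φ ψ : C(K, ℂ)}

lemma add (hφ : SmallApprox a K φ) (hψ : SmallApprox a K ψ) : SmallApprox a K (φ + ψ) := by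
  intro ε hε
  obtain ⟨h₁, R₁, hR₁, hd₁, hb₁, hK₁⟩ := hφ (ε / 2) (by positivity)
  obtain ⟨h₂, R₂, hR₂, hd₂, hb₂, hK₂⟩ := hψ (ε / 2) (by positivity)
  refine ⟨fun z => h₁ z + h₂ z, min R₁ R₂, lt_min hR₁ hR₂,
    (hd₁.mono (ball_subset_ball (min_le_left _ _))).add
      (hd₂.mono (ball_subset_ball (min_le_right _ _))), fun z hz => ?_, fun ζ => ?_⟩
  · refine (norm_add_le_of_le (hb₁ z hz) (hb₂ z hz)).trans_eq ?_
    ring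
  · rw [ContinuousMap.add_apply, add_sub_add_comm]
    exact (norm_add_le_of_le (hK₁ ζ) (hK₂ ζ)).trans_eq (by ring)

lemma const_mul (hφ : SmallApprox a K φ) (c : ℂ) :
    SmallApprox a K (ContinuousMap.const K c * φ) := by
  intro ε hε
  have hc : 0 < ‖c‖ + 1 := by positivity
  obtain ⟨h, R, hR, hd, hb, hK⟩ := hφ (ε / (‖c‖ + 1)) (by positivity)
  have hle : ‖c‖ * (ε / (‖c‖ + 1)) ≤ ε := by
    rw [mul_div_assoc', div_le_iff₀ hc]
    nlinarith [norm_nonneg c]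
  refine ⟨fun z => c * h z, R, hR, hd.const_mul c, fun z hz => ?_, fun ζ => ?_⟩
  · have hz1 : 0 < 1 - ‖z‖ := by rw [mem_ball_zero_iff] at hz; linarith
    calc ‖c * h z‖ ≤ ‖c‖ * (ε / (‖c‖ + 1) * (1 - ‖z‖) ^ (-a)) := by
          rw [norm_mul]
          gcongr
          exact hb z hz
      _ = ‖c‖ * (ε / (‖c‖ + 1)) * (1 - ‖z‖) ^ (-a) := by ring
      _ ≤ _ := by gcongr
  · rw [ContinuousMap.mul_apply, ContinuousMap.const_apply, ← mul_sub, norm_mul]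
    refine le_trans ?_ hle
    gcongr
    exact hK ζ

lemma id_mul (hKT : K ⊆ sphere (0 : ℂ) 1) (hφ : SmallApprox a K φ) :
    SmallApprox a K (.restrict K (.id ℂ) * φ) := by
  intro ε hε
  obtain ⟨h, R, hR, hd, hb, hK⟩ := hφ ε hε
  refine ⟨fun z => z * h z, R, hR, differentiableOn_id.mul hd, fun z hz => ?_, fun ζ => ?_⟩
  · refine le_trans ?_ (hb z hz)
    rw [norm_mul]
    exact mul_le_of_le_one_left (norm_nonneg _) (mem_ball_zero_iff.1 hz).le
  · have hζ : ‖(ζ : ℂ)‖ = 1 := by simpa using hKT ζ.2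
    simp only [ContinuousMap.mul_apply, ContinuousMap.restrict_apply, ContinuousMap.id_apply]
    rw [← mul_sub, norm_mul, hζ, one_mul]
    exact hK ζ

lemma star_id_mul (ha : 0 ≤ a) (hKT : K ⊆ sphere (0 : ℂ) 1) (hφ : SmallApprox a K φ) :
    SmallApprox a K (star (.restrict K (.id ℂ)) * φ) := by
  intro ε hε
  set C : ℝ := 2 * ((1 / 2) ^ (-a) + 1) with hC
  have h2a : (1 : ℝ) ≤ (1 / 2) ^ (-a) :=
    Real.one_le_rpow_of_pos_of_le_one_of_nonpos (by norm_num) (by norm_num) (by linarith)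
  have hC4 : 4 ≤ C := by rw [hC]; linarith
  obtain ⟨h, R, hR, hd, hb, hK⟩ := hφ (ε / C) (by positivity)
  set η := ε / C with hη
  have hη0 : 0 < η := by positivity
  have hηC : C * η = ε := by rw [hη]; field_simp
  have hnhds : ball (0 : ℂ) R ∈ 𝓝 0 := ball_mem_nhds _ (by linarith)
  have h0 : ‖h 0‖ ≤ η := by simpa using hb 0 (by simp)
  refine ⟨dslope h 0, R, hR, (differentiableOn_dslope hnhds).2 hd, fun z hz => ?_, fun ζ => ?_⟩
  · have hz1 : ‖z‖ < 1 := by rwa [mem_ball_zero_iff] at hz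
    have hw := one_le_one_sub_norm_rpow_neg hz1 ha
    by_cases hz2 : ‖z‖ < 1 / 2
    · have hmaps : MapsTo h (ball 0 (1 / 2)) (closedBall (h 0) (η * ((1 / 2) ^ (-a) + 1))) := by
        intro y hy
        have hy2 : ‖y‖ < 1 / 2 := by rwa [mem_ball_zero_iff] at hy
        rw [mem_closedBall, dist_eq_norm]
        refine (norm_sub_le_of_le (hb y (by rw [mem_ball_zero_iff]; linarith)) h0).trans ?_
        rw [mul_add, mul_one]
        gcongr η * ?_ + _
        exact Real.rpow_le_rpow_of_nonpos (by norm_num) (by linarith) (by linarith)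
      have h1 := norm_dslope_le_div_of_mapsTo_ball (hd.mono (ball_subset_ball (by linarith))) hmaps
        (by rwa [mem_ball_zero_iff])
      refine h1.trans ?_
      calc η * ((1 / 2) ^ (-a) + 1) / (1 / 2) = C * η * 1 := by rw [hC]; ring
        _ = ε * 1 := by rw [hηC]
        _ ≤ _ := by gcongr
    · push Not at hz2
      have hz0 : z ≠ 0 := by
        rintro rfl
        norm_num at hz2
      rw [dslope_of_ne _ hz0, slope_def_field, sub_zero, norm_div]
      calc ‖h z - h 0‖ / ‖z‖ ≤ (η * (1 - ‖z‖) ^ (-a) + η * 1) / (1 / 2) := by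
            gcongr
            rw [mul_one]
            exact norm_sub_le_of_le (hb z hz) h0
        _ ≤ (η * (1 - ‖z‖) ^ (-a) + η * (1 - ‖z‖) ^ (-a)) / (1 / 2) := by gcongr
        _ = 4 * η * (1 - ‖z‖) ^ (-a) := by ring
        _ ≤ C * η * (1 - ‖z‖) ^ (-a) := by gcongr
        _ = _ := by rw [hηC]
  · have hζ : ‖(ζ : ℂ)‖ = 1 := by simpa using hKT ζ.2
    have hζ0 : (ζ : ℂ) ≠ 0 := by rw [← norm_pos_iff, hζ]; exact one_pos
    have hstar : star (ζ : ℂ) = (ζ : ℂ)⁻¹ := by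
      rw [Complex.inv_eq_conj hζ]
      rfl
    rw [dslope_of_ne _ hζ0, slope_def_field, sub_zero]
    simp only [ContinuousMap.mul_apply, ContinuousMap.star_apply, ContinuousMap.restrict_apply,
      ContinuousMap.id_apply, hstar]
    rw [show (h ζ - h 0) / (ζ : ℂ) - (ζ : ℂ)⁻¹ * φ ζ = (ζ : ℂ)⁻¹ * ((h ζ - φ ζ) - h 0) by ring,
      norm_mul, norm_inv, hζ, inv_one, one_mul]
    refine (norm_sub_le_of_le (hK ζ) h0).trans ?_
    rw [← hηC]
    nlinarith

lemma of_frequently [CompactSpace K] (h : ∃ᶠ ψ in 𝓝 φ, SmallApprox a K ψ) :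
    SmallApprox a K φ := by
  intro ε hε
  obtain ⟨ψ, hψ, hψφ⟩ := (h.and_eventually (Metric.ball_mem_nhds φ (half_pos hε))).exists
  obtain ⟨g, R, hR, hd, hb, hK⟩ := hψ (ε / 2) (by positivity)
  refine ⟨g, R, hR, hd, fun z hz => (hb z hz).trans ?_, fun ζ => ?_⟩
  · have hz1 : 0 < 1 - ‖z‖ := by rw [mem_ball_zero_iff] at hz; linarith
    gcongr
    linarith
  · have h1 : ‖ψ ζ - φ ζ‖ ≤ ε / 2 := by
      rw [← dist_eq_norm]
      exact (ContinuousMap.dist_apply_le_dist ζ).trans (mem_ball.1 hψφ).le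
    have h2 := norm_sub_le_norm_sub_add_norm_sub (g ζ) (ψ ζ) (φ ζ)
    linarith [hK ζ]

end SmallApprox

lemma smallApprox_of_admissible {K : Set ℂ} (hKc : IsCompact K)
    (hKT : K ⊆ sphere (0 : ℂ) 1) (hK : BergmanAdmissible K) {a : ℝ} (ha : 0 < a) (φ : C(K, ℂ)) :
    SmallApprox a K φ := by
  have : CompactSpace K := isCompact_iff_compactSpace.1 hKc
  have hone : SmallApprox a K 1 := by
    intro ε hε
    obtain ⟨h, R, hR, hd, hb, h1⟩ := exists_differentiableOn_near_one hKc hKT hK ha hε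
    exact ⟨h, R, hR, hd, hb, fun ζ => h1 ζ ζ.2⟩
  have hmul : ∀ ψ : C(K, ℂ), SmallApprox a K ψ → SmallApprox a K (φ * ψ) := by
    induction φ using ContinuousMap.induction_on_of_compact with
    | const r => exact fun ψ hψ => hψ.const_mul r
    | id => exact fun ψ hψ => hψ.id_mul hKT
    | star_id => exact fun ψ hψ => hψ.star_id_mul ha.le hKT
    | add f g hf hg =>
      intro ψ hψ
      rw [add_mul]
      exact (hf ψ hψ).add (hg ψ hψ)
    | mul f g hf hg =>
      intro ψ hψ
      rw [mul_assoc]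
      exact hf _ (hg ψ hψ)
    | frequently f hf =>
      intro ψ hψ
      refine SmallApprox.of_frequently ?_
      have hc : Tendsto (fun g : C(K, ℂ) => g * ψ) (𝓝 f) (𝓝 (f * ψ)) :=
        (continuous_id.mul continuous_const).tendsto f
      exact hc.frequently (hf.mono fun g hg => hg ψ hψ)
  simpa using hmul 1 hone

/-- Simultaneous approximation: a function holomorphic near the closed disk can be changed by a
small amount in the weighted sup norm so that its `l`-th derivative is close to a given continuous
function on `K`. -/
lemma exists_approx_iteratedDeriv {K : Set ℂ} (hKc : IsCompact K)
    (hKT : K ⊆ sphere (0 : ℂ) 1) (hK : BergmanAdmissible K) {a : ℝ} (ha : 0 < a) (φ : C(K, ℂ))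
    {ε : ℝ} (hε : 0 < ε) (l : ℕ) {f : ℂ → ℂ} {R : ℝ} (hR : 1 < R)
    (hf : DifferentiableOn ℂ f (ball 0 R)) :
    ∃ (g : ℂ → ℂ) (S : ℝ), 1 < S ∧ DifferentiableOn ℂ g (ball 0 S) ∧
      (∀ z ∈ ball (0 : ℂ) 1, ‖g z - f z‖ ≤ ε * (1 - ‖z‖) ^ (-a)) ∧
      ∀ ζ : K, ‖iteratedDeriv l g ζ - φ ζ‖ ≤ ε := by
  have hKR : ∀ S : ℝ, 1 < S → ∀ ζ : K, (ζ : ℂ) ∈ ball (0 : ℂ) S := by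
    intro S hS ζ
    have hζ : ‖(ζ : ℂ)‖ = 1 := by simpa using hKT ζ.2
    rwa [mem_ball_zero_iff, hζ]
  induction l generalizing f R with
  | zero =>
    have hfc : ContinuousOn f K := hf.continuousOn.mono fun ζ hζ => hKR R hR ⟨ζ, hζ⟩
    let fK : C(K, ℂ) := ⟨K.domRestrict f, hfc.domRestrict⟩
    obtain ⟨h, S, hS, hd, hb, h1⟩ := smallApprox_of_admissible hKc hKT hK ha (φ - fK) ε hε
    refine ⟨fun z => f z + h z, min R S, lt_min hR hS,
      (hf.mono (ball_subset_ball (min_le_left _ _))).add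
        (hd.mono (ball_subset_ball (min_le_right _ _))), fun z hz => ?_, fun ζ => ?_⟩
    · simpa using hb z hz
    · have := h1 ζ
      simp only [ContinuousMap.sub_apply] at this
      rw [iteratedDeriv_zero]
      refine le_of_eq_of_le ?_ this
      congr 1
      change _ = h ζ - (φ ζ - f ζ)
      ring
  | succ l ih =>
    obtain ⟨g₁, S, hS, hd, hb, h1⟩ := ih hR (hf.deriv isOpen_ball)
    set T := min R S with hT
    have hT1 : 1 < T := lt_min hR hS
    have hd' := hd.mono (ball_subset_ball (min_le_right R S))
    have hf' := hf.mono (ball_subset_ball (min_le_left R S))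
    obtain ⟨g, hg0, hg⟩ := hd'.isExactOn_ball.with_val_at 0 (f 0)
    refine ⟨g, T, hT1, fun z hz => (hg z hz).differentiableAt.differentiableWithinAt,
      fun z hz => ?_, fun ζ => ?_⟩
    · have hz1 : ‖z‖ < 1 := by rwa [mem_ball_zero_iff] at hz
      have hmv := (convex_closedBall (0 : ℂ) ‖z‖).norm_image_sub_le_of_norm_hasDerivWithin_le
        (f := fun y => g y - f y) (f' := fun y => g₁ y - deriv f y)
        (C := ε * (1 - ‖z‖) ^ (-a)) (x := 0) (y := z) ?_ ?_ (by simp) (by simp)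
      · simp only [hg0, sub_self, sub_zero] at hmv
        refine hmv.trans (mul_le_of_le_one_right ?_ hz1.le)
        have : 0 < 1 - ‖z‖ := by linarith
        positivity
      · intro y hy
        rw [mem_closedBall_zero_iff] at hy
        have hyT : y ∈ ball (0 : ℂ) T := by rw [mem_ball_zero_iff]; linarith
        have h2 : HasDerivAt f (deriv f y) y :=
          (hf'.differentiableAt (isOpen_ball.mem_nhds hyT)).hasDerivAt
        exact ((hg y hyT).sub h2).hasDerivWithinAt
      · intro y hy
        rw [mem_closedBall_zero_iff] at hy
        refine (hb y (by rw [mem_ball_zero_iff]; linarith)).trans ?_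
        gcongr ε * ?_
        exact Real.rpow_le_rpow_of_nonpos (by linarith) (by linarith) (by linarith)
    · have h2 : deriv g =ᶠ[𝓝 (ζ : ℂ)] g₁ := by
        filter_upwards [isOpen_ball.mem_nhds (hKR T hT1 ζ)] with y hy using (hg y hy).deriv
      rw [iteratedDeriv_succ', h2.iteratedDeriv_eq]
      exact h1 ζ

section AreaMean

lemma enorm_mul_le_lintegral_circleMap {u : ℂ → ℂ} {w : ℂ} {δ r : ℝ}
    (hu : DifferentiableOn ℂ u (ball w δ)) (hr : 0 < r) (hrδ : r < δ) :
    ENNReal.ofReal (2 * Real.pi) * ‖u w‖ₑ ≤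
      ∫⁻ θ in Ioo (-Real.pi) Real.pi, ‖u (circleMap w r θ)‖ₑ := by
  have hd : DiffContOnCl ℂ u (ball w |r|) := by
    refine DifferentiableOn.diffContOnCl (hu.mono ?_)
    rw [abs_of_pos hr, closure_ball _ hr.ne']
    exact closedBall_subset_ball hrδ
  have h := hd.circleAverage
  rw [Real.circleAverage_eq_integral_add (-Real.pi), intervalIntegral.integral_comp_add_right
    (fun θ => u (circleMap w r θ)), zero_add,
    show 2 * Real.pi + -Real.pi = Real.pi by ring,
    intervalIntegral.integral_of_le (by linarith [Real.pi_pos]), integral_Ioc_eq_integral_Ioo] at h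
  have h2 : ((2 * Real.pi : ℝ) : ℂ) * u w =
      ∫ θ in Ioo (-Real.pi) Real.pi, u (circleMap w r θ) := by
    rw [← h, ← Complex.real_smul, smul_smul, mul_inv_cancel₀ (by positivity), one_smul]
  calc ENNReal.ofReal (2 * Real.pi) * ‖u w‖ₑ = ‖((2 * Real.pi : ℝ) : ℂ) * u w‖ₑ := by
        rw [enorm_mul, ← ofReal_norm ((2 * Real.pi : ℝ) : ℂ), Complex.norm_real,
          Real.norm_of_nonneg (by positivity)]
    _ = _ := by rw [h2]
    _ ≤ _ := enorm_integral_le_lintegral_enorm _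

lemma lintegral_ofReal_Ioo {δ : ℝ} (hδ : 0 ≤ δ) :
    ∫⁻ r in Ioo 0 δ, ENNReal.ofReal r = ENNReal.ofReal (δ ^ 2 / 2) := by
  rw [← ofReal_integral_eq_lintegral_ofReal, ← integral_Ioc_eq_integral_Ioo,
    ← intervalIntegral.integral_of_le hδ, integral_id]
  · norm_num
  · exact (continuous_id.integrableOn_Icc (a := 0) (b := δ)).mono_set Ioo_subset_Icc_self
  · filter_upwards [ae_restrict_mem measurableSet_Ioo] with r hr using hr.1.le

lemma enorm_mul_le_lintegral_ball {u : ℂ → ℂ} {w : ℂ} {δ : ℝ} (hδ : 0 ≤ δ)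
    (hu : DifferentiableOn ℂ u (ball w δ)) :
    ENNReal.ofReal (Real.pi * δ ^ 2) * ‖u w‖ₑ ≤ ∫⁻ z in ball w δ, ‖u z‖ₑ := by
  set F : ℂ → ENNReal := fun z => (ball (0 : ℂ) δ).indicator (fun z => ‖u (w + z)‖ₑ) z with hF
  have hmeas : Measurable F := by
    have hc : ContinuousOn (fun z => ‖u (w + z)‖ₑ) (ball (0 : ℂ) δ) := by
      refine continuous_enorm.comp_continuousOn (hu.continuousOn.comp (by fun_prop) ?_)
      intro z hz
      simpa using hz
    classical
    have := hc.measurable_piecewise (g := (0 : ℂ → ENNReal)) continuousOn_const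
      isOpen_ball.measurableSet
    rwa [Set.piecewise_eq_indicator] at this
  have h1 : ∫⁻ z in ball w δ, ‖u z‖ₑ = ∫⁻ z, F z := by
    rw [hF, lintegral_indicator isOpen_ball.measurableSet]
    have := (measurePreserving_add_left (volume : Measure ℂ) w).setLIntegral_comp_preimage_emb
      (measurableEmbedding_addLeft w) (fun z => ‖u z‖ₑ) (ball w δ)
    rw [← this]
    congr 3
    ext z
    simp
  rw [h1, ← Complex.lintegral_comp_polarCoord_symm, polarCoord_target]
  have hmeas2 : Measurable fun p : ℝ × ℝ =>
      ENNReal.ofReal p.1 • F (Complex.polarCoord.symm p) := by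
    simp only [Complex.polarCoord_symm_apply, smul_eq_mul]
    refine Measurable.mul (by fun_prop) (hmeas.comp (by fun_prop))
  rw [Measure.volume_eq_prod, ← Measure.prod_restrict, lintegral_prod _ hmeas2.aemeasurable]
  calc ENNReal.ofReal (Real.pi * δ ^ 2) * ‖u w‖ₑ
      = ∫⁻ r in Ioo 0 δ, ENNReal.ofReal r * (ENNReal.ofReal (2 * Real.pi) * ‖u w‖ₑ) := by
        rw [lintegral_mul_const _ (by fun_prop), lintegral_ofReal_Ioo hδ, ← mul_assoc,
          ← ENNReal.ofReal_mul (by positivity)]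
        ring_nf
    _ ≤ ∫⁻ r in Ioo 0 δ, ∫⁻ θ in Ioo (-Real.pi) Real.pi,
          ENNReal.ofReal r • F (Complex.polarCoord.symm (r, θ)) := by
        refine setLIntegral_mono' measurableSet_Ioo fun r hr => ?_
        simp only [smul_eq_mul]
        rw [lintegral_const_mul']
        · gcongr
          refine (enorm_mul_le_lintegral_circleMap hu hr.1 hr.2).trans (le_of_eq ?_)
          refine lintegral_congr fun θ => ?_
          have hcm : circleMap w r θ = w + Complex.polarCoord.symm (r, θ) := by
            rw [Complex.polarCoord_symm_apply, circleMap, Complex.exp_mul_I]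
            simp
          rw [hcm, hF]
          simp only
          rw [indicator_of_mem]
          rw [mem_ball_zero_iff, Complex.norm_polarCoord_symm]
          simpa [abs_of_pos hr.1] using hr.2
        · exact ENNReal.ofReal_ne_top
    _ ≤ _ := lintegral_mono_set Ioo_subset_Ioi_self

end AreaMean

section Bergman

/-- Normalised area measure on the unit disc. -/
def discMeasure : Measure ℂ := ENNReal.ofReal Real.pi⁻¹ • volume.restrict (ball 0 1)

instance : IsProbabilityMeasure discMeasure := by
  constructor
  rw [discMeasure, Measure.smul_apply, Measure.restrict_apply_univ, Complex.volume_ball,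
    smul_eq_mul]
  have : (NNReal.pi : ENNReal) = ENNReal.ofReal Real.pi := by
    rw [← NNReal.coe_real_pi, ENNReal.ofReal_coe_nnreal]
  rw [this]
  norm_num
  rw [← ENNReal.ofReal_mul (by positivity), inv_mul_cancel₀ Real.pi_ne_zero, ENNReal.ofReal_one]

lemma lintegral_ball_eq_discMeasure (f : ℂ → ENNReal) :
    ∫⁻ z in ball 0 1, f z = ENNReal.ofReal Real.pi * ∫⁻ z, f z ∂discMeasure := by
  rw [discMeasure, lintegral_smul_measure, smul_eq_mul, ← mul_assoc,
    ← ENNReal.ofReal_mul (by positivity), mul_inv_cancel₀ Real.pi_ne_zero, ENNReal.ofReal_one,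
    one_mul]

lemma ae_discMeasure_iff {q : ℂ → Prop} :
    (∀ᵐ z ∂discMeasure, q z) ↔ ∀ᵐ z ∂(volume.restrict (ball (0 : ℂ) 1)), q z := by
  rw [discMeasure, Measure.ae_ennreal_smul_measure_iff]
  simpa using Real.pi_pos

lemma integrableOn_ball_iff {E : Type*} [NormedAddCommGroup E] {f : ℂ → E} :
    IntegrableOn f (ball 0 1) ↔ Integrable f discMeasure := by
  rw [discMeasure, integrable_smul_measure, IntegrableOn]
  · simpa using Real.pi_pos
  · simp

variable {p : ℝ} {f g : ℂ → ℂ}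

lemma aestronglyMeasurable_discMeasure (hf : DifferentiableOn ℂ f (ball 0 1)) :
    AEStronglyMeasurable f discMeasure :=
  (hf.continuousOn.aestronglyMeasurable isOpen_ball.measurableSet).smul_measure _

lemma memAp_iff (hp : 0 < p) : MemAp p f ↔
    DifferentiableOn ℂ f (ball 0 1) ∧ MemLp f (ENNReal.ofReal p) discMeasure := by
  rw [MemAp, and_congr_right_iff]
  intro hf
  rw [integrableOn_ball_iff, ← integrable_norm_rpow_iff (aestronglyMeasurable_discMeasure hf)
    (by simpa using hp) ENNReal.ofReal_ne_top, ENNReal.toReal_ofReal hp.le]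

lemma bergmanNorm_eq (p : ℝ) (f : ℂ → ℂ) :
    bergmanNorm p f = (∫ z, ‖f z‖ ^ p ∂discMeasure) ^ (1 / p) := by
  rw [bergmanNorm, discMeasure, integral_smul_measure, ENNReal.toReal_ofReal (by positivity),
    smul_eq_mul]

lemma eLpNorm_eq_bergmanNorm (hp : 0 < p) (hf : MemAp p f) :
    eLpNorm f (ENNReal.ofReal p) discMeasure = ENNReal.ofReal (bergmanNorm p f) := by
  rw [((memAp_iff hp).1 hf).2.eLpNorm_eq_integral_rpow_norm (by simpa using hp)
    ENNReal.ofReal_ne_top, ENNReal.toReal_ofReal hp.le, bergmanNorm_eq, one_div]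

lemma MemAp.sub (hp : 0 < p) (hf : MemAp p f) (hg : MemAp p g) :
    MemAp p (fun z => f z - g z) := by
  rw [memAp_iff hp] at *
  exact ⟨hf.1.sub hg.1, hf.2.sub hg.2⟩

lemma enorm_le_eLpNorm (hp : 1 ≤ p) (hf : DifferentiableOn ℂ f (ball 0 1)) {w : ℂ} {δ : ℝ}
    (hδ : 0 < δ) (hw : ‖w‖ + δ ≤ 1) :
    ‖f w‖ₑ ≤ ENNReal.ofReal ((δ ^ 2)⁻¹) * eLpNorm f (ENNReal.ofReal p) discMeasure := by
  have hsub : ball w δ ⊆ ball 0 1 := ball_subset_ball' (by rw [dist_zero_right]; linarith)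
  have h := enorm_mul_le_lintegral_ball hδ.le (hf.mono hsub)
  have h2 : ∫⁻ z in ball w δ, ‖f z‖ₑ ≤
      ENNReal.ofReal Real.pi * eLpNorm f (ENNReal.ofReal p) discMeasure := by
    refine (lintegral_mono_set hsub).trans ?_
    rw [lintegral_ball_eq_discMeasure, ← eLpNorm_one_eq_lintegral_enorm]
    gcongr
    exact eLpNorm_le_eLpNorm_of_exponent_le (by simpa using hp)
      (aestronglyMeasurable_discMeasure hf)
  have h3 : ENNReal.ofReal ((Real.pi * δ ^ 2)⁻¹) * (ENNReal.ofReal (Real.pi * δ ^ 2) * ‖f w‖ₑ) =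
      ‖f w‖ₑ := by
    rw [← mul_assoc, ← ENNReal.ofReal_mul (by positivity), inv_mul_cancel₀ (by positivity),
      ENNReal.ofReal_one, one_mul]
  rw [← h3]
  refine (mul_le_mul_right (h.trans h2) _).trans (le_of_eq ?_)
  rw [← mul_assoc, ← ENNReal.ofReal_mul (by positivity)]
  congr 2
  field_simp

end Bergman

section BergmanTopology

variable {p : ℝ}

/-- The Bergman distance as an extended pseudometric. -/
@[reducible] def bergmanPseudoEMetric (hp : 1 ≤ p) : PseudoEMetricSpace (ApSpace p) where
  edist f g := eLpNorm (fun z => f.1 z - g.1 z) (ENNReal.ofReal p) discMeasure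
  edist_self f := by simp
  edist_comm f g := eLpNorm_sub_comm _ _ _ _
  edist_triangle f g h := by
    have hfg := (f.2.sub (by linarith) g.2).1
    have hgh := (g.2.sub (by linarith) h.2).1
    refine le_trans (le_of_eq ?_) (eLpNorm_add_le (aestronglyMeasurable_discMeasure hfg)
      (aestronglyMeasurable_discMeasure hgh) (by simpa using hp))
    congr 1
    ext z
    simp

lemma isOpen_apSpace_iff (hp : 1 ≤ p) {U : Set (ApSpace p)} :
    IsOpen U ↔ ∀ f ∈ U, ∃ ε > 0, ∀ g : ApSpace p,
      eLpNorm (fun z => g.1 z - f.1 z) (ENNReal.ofReal p) discMeasure < ε → g ∈ U := by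
  have key : apTopology p = (bergmanPseudoEMetric hp).toUniformSpace.toTopologicalSpace := by
    apply le_antisymm
    · intro U hU
      have hU' := (@EMetric.isOpen_iff _ (bergmanPseudoEMetric hp) U).1 hU
      refine (@isOpen_iff_mem_nhds _ (apTopology p) U).2 fun f hf => ?_
      obtain ⟨ε, hε, hεU⟩ := hU' f hf
      obtain ⟨δ, hδ, hδε⟩ := ENNReal.lt_iff_exists_nnreal_btwn.1 hε
      have hδ0 : (0 : ℝ) < δ := by exact_mod_cast hδ
      refine Filter.mem_of_superset (@IsOpen.mem_nhds _ (apTopology p) f _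
        (TopologicalSpace.isOpen_generateFrom_of_mem ⟨f, δ, hδ0, rfl⟩) ?_) fun g hg => hεU ?_
      · have h0 : bergmanNorm p (fun z => f.1 z - f.1 z) = 0 := by
          simp [bergmanNorm, Real.zero_rpow (by linarith : p ≠ 0),
            Real.zero_rpow (inv_ne_zero (by linarith : p ≠ 0))]
        simpa only [mem_ofPred_eq, h0] using hδ0
      · refine lt_trans ?_ hδε
        change eLpNorm (fun z => g.1 z - f.1 z) _ _ < _
        rw [eLpNorm_eq_bergmanNorm (by linarith) (g.2.sub (by linarith) f.2),
          ← ENNReal.ofReal_coe_nnreal]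
        exact (ENNReal.ofReal_lt_ofReal_iff hδ0).2 hg
    · refine le_generateFrom ?_
      rintro U ⟨f, ε, hε, rfl⟩
      convert @Metric.isOpen_eball _ (bergmanPseudoEMetric hp) f (ENNReal.ofReal ε) using 1
      ext g
      change _ ↔ eLpNorm (fun z => g.1 z - f.1 z) _ _ < _
      rw [eLpNorm_eq_bergmanNorm (by linarith) (g.2.sub (by linarith) f.2)]
      exact (ENNReal.ofReal_lt_ofReal_iff hε).symm
  rw [key]
  exact @EMetric.isOpen_iff _ (bergmanPseudoEMetric hp) U

lemma baireSpace_of_edist {X : Type*} [T : TopologicalSpace X] (E : PseudoEMetricSpace X)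
    (hT : ∀ U : Set X, IsOpen U ↔ ∀ x ∈ U, ∃ ε > 0, ∀ y, edist y x < ε → y ∈ U)
    (hE : ∀ u : ℕ → X, (∀ ε > 0, ∃ N, ∀ m ≥ N, ∀ n ≥ N, edist (u m) (u n) < ε) →
      ∃ a, ∀ ε > 0, ∃ N, ∀ n ≥ N, edist (u n) a ≤ ε) : BaireSpace X := by
  have key : T = E.toUniformSpace.toTopologicalSpace := by
    refine TopologicalSpace.ext_iff.2 fun U => ?_
    rw [hT U]
    exact (@EMetric.isOpen_iff X E U).symm
  subst key
  have : CompleteSpace X := by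
    refine EMetric.complete_of_cauchySeq_tendsto fun u hu => ?_
    obtain ⟨a, ha⟩ := hE u (EMetric.cauchySeq_iff.1 hu)
    refine ⟨a, EMetric.tendsto_atTop.2 fun ε hε => ?_⟩
    obtain ⟨δ, hδ0, hδ⟩ := exists_between hε
    obtain ⟨N, hN⟩ := ha δ hδ0
    exact ⟨N, fun n hn => (hN n hn).trans_lt hδ⟩
  infer_instance

lemma exists_limit_of_cauchy (hp : 1 ≤ p) (u : ℕ → ApSpace p)
    (hu : ∀ ε > 0, ∃ N, ∀ m ≥ N, ∀ n ≥ N,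
      eLpNorm (fun z => (u m).1 z - (u n).1 z) (ENNReal.ofReal p) discMeasure < ε) :
    ∃ a : ApSpace p, ∀ ε > 0, ∃ N, ∀ n ≥ N,
      eLpNorm (fun z => (u n).1 z - a.1 z) (ENNReal.ofReal p) discMeasure ≤ ε := by
  have hp0 : 0 < p := by linarith
  have hloc : ∀ s < 1, UniformCauchySeqOn (fun n => (u n).1) atTop (ball (0 : ℂ) s) := by
    intro s hs
    rw [Metric.uniformCauchySeqOn_iff]
    intro ε hε
    have hδ : 0 < 1 - s := by linarith
    obtain ⟨N, hN⟩ := hu (ENNReal.ofReal (ε * (1 - s) ^ 2)) (by simpa using by positivity)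
    refine ⟨N, fun m hm n hn w hw => ?_⟩
    have hw' : ‖w‖ + (1 - s) ≤ 1 := by
      have := mem_ball_zero_iff.1 hw
      linarith
    have h := (enorm_le_eLpNorm hp ((u m).2.sub hp0 (u n).2).1 hδ hw').trans_lt
      (ENNReal.mul_lt_mul_right (by simpa using by positivity) ENNReal.ofReal_ne_top
        (hN m hm n hn))
    rw [← ENNReal.ofReal_mul (by positivity), ← ofReal_norm,
      ENNReal.ofReal_lt_ofReal_iff (by positivity)] at h
    rw [dist_eq_norm]
    refine h.trans_le (le_of_eq ?_)
    field_simp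
  have hpt : ∀ z ∈ ball (0 : ℂ) 1, ∃ y, Tendsto (fun n => (u n).1 z) atTop (𝓝 y) := by
    intro z hz
    obtain ⟨s, hzs, hs⟩ := exists_between (mem_ball_zero_iff.1 hz)
    exact cauchySeq_tendsto_of_complete ((hloc s hs).cauchySeq (mem_ball_zero_iff.2 hzs))
  choose! g hg using hpt
  have hgd : DifferentiableOn ℂ g (ball 0 1) := by
    refine TendstoLocallyUniformlyOn.differentiableOn (F := fun n => (u n).1) (φ := atTop) ?_
      (Eventually.of_forall fun n => (u n).2.1) isOpen_ball
    rw [tendstoLocallyUniformlyOn_iff_forall_isCompact isOpen_ball]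
    intro L hL hLc
    obtain ⟨s, hs, hLs⟩ : ∃ s < 1, L ⊆ ball (0 : ℂ) s := by
      obtain ⟨s, hs, h⟩ := exists_lt_subset_ball hLc.isClosed hL
      exact ⟨s, hs, h⟩
    exact ((hloc s hs).tendstoUniformlyOn_of_tendsto
      fun z hz => hg z (ball_subset_ball hs.le hz)).mono hLs
  have hlim : ∀ N : ℕ, ∀ ε : ENNReal, (∀ m ≥ N, ∀ n ≥ N,
      eLpNorm (fun z => (u m).1 z - (u n).1 z) (ENNReal.ofReal p) discMeasure < ε) →
      ∀ n ≥ N, eLpNorm (fun z => (u n).1 z - g z) (ENNReal.ofReal p) discMeasure ≤ ε := by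
    intro N ε hN n hn
    refine Lp.eLpNorm_le_of_ae_tendsto (u := atTop) (f := fun m z => (u n).1 z - (u m).1 z) ?_
      (fun m => aestronglyMeasurable_discMeasure ((u n).2.sub hp0 (u m).2).1) ?_
    · filter_upwards [eventually_ge_atTop N] with m hm using (hN n hn m hm).le
    · rw [ae_discMeasure_iff]
      filter_upwards [ae_restrict_mem isOpen_ball.measurableSet] with z hz
      exact tendsto_const_nhds.sub (hg z hz)
  have hgm : MemAp p g := by
    obtain ⟨N, hN⟩ := hu 1 one_pos
    refine (memAp_iff hp0).2 ⟨hgd, ?_⟩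
    have h1 : MemLp (fun z => (u N).1 z - g z) (ENNReal.ofReal p) discMeasure :=
      ⟨aestronglyMeasurable_discMeasure ((u N).2.1.sub hgd),
        (hlim N 1 hN N le_rfl).trans_lt ENNReal.one_lt_top⟩
    have h2 := ((memAp_iff hp0).1 (u N).2).2.sub h1
    convert h2 using 1
    ext z
    simp
  refine ⟨⟨g, hgm⟩, fun ε hε => ?_⟩
  obtain ⟨N, hN⟩ := hu ε hε
  exact ⟨N, hlim N ε hN⟩

lemma baireSpace_apSpace (hp : 1 ≤ p) : BaireSpace (ApSpace p) :=
  baireSpace_of_edist (bergmanPseudoEMetric hp) (fun _ => isOpen_apSpace_iff hp)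
    (exists_limit_of_cauchy hp)

end BergmanTopology

section BergmanApprox

variable {p : ℝ} {f g : ℂ → ℂ}

lemma memAp_of_differentiableOn_ball (hp : 0 < p) {R : ℝ} (hR : 1 < R)
    (hf : DifferentiableOn ℂ f (ball 0 R)) : MemAp p f := by
  have hd := hf.mono (ball_subset_ball hR.le)
  refine (memAp_iff hp).2 ⟨hd, ?_⟩
  obtain ⟨C, hC⟩ := (isCompact_closedBall (0 : ℂ) 1).exists_bound_of_continuousOn
    (hf.continuousOn.mono (closedBall_subset_ball hR))
  refine MemLp.of_bound (aestronglyMeasurable_discMeasure hd) C ?_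
  rw [ae_discMeasure_iff]
  filter_upwards [ae_restrict_mem isOpen_ball.measurableSet] with z hz
  exact hC z (ball_subset_closedBall hz)

lemma discMeasure_le_volume : discMeasure ≤ volume := by
  refine le_trans ?_ (Measure.restrict_le_self (s := ball (0 : ℂ) 1))
  intro s
  rw [discMeasure, Measure.smul_apply, smul_eq_mul]
  refine mul_le_of_le_one_left zero_le (ENNReal.ofReal_le_one.2 ?_)
  exact inv_le_one_of_one_le₀ (by linarith [Real.pi_gt_three])

lemma eLpNorm_comp_smul_le (hp : 1 ≤ p) (hf : AEStronglyMeasurable f volume) {s : ℝ}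
    (hs : 1 / 2 ≤ s) :
    eLpNorm (fun z => f (s • z)) (ENNReal.ofReal p) volume ≤
      4 * eLpNorm f (ENNReal.ofReal p) volume := by
  have hs0 : s ≠ 0 := by
    rintro rfl
    norm_num at hs
  have hmap := Measure.map_addHaar_smul (volume : Measure ℂ) hs0
  rw [Complex.finrank_real_complex] at hmap
  have hc : ENNReal.ofReal |(s ^ 2)⁻¹| ≤ 4 := by
    rw [show (4 : ENNReal) = ENNReal.ofReal 4 by norm_num]
    refine ENNReal.ofReal_le_ofReal ?_
    rw [abs_of_nonneg (by positivity)]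
    refine inv_le_of_inv_le₀ (by norm_num) ?_
    nlinarith
  have h := eLpNorm_map_measure (p := ENNReal.ofReal p) (f := fun z : ℂ => s • z) (g := f)
    (μ := volume) (by rw [hmap]; exact hf.smul_measure _) (by fun_prop)
  rw [hmap, eLpNorm_smul_measure_of_ne_top ENNReal.ofReal_ne_top, smul_eq_mul] at h
  refine (le_of_eq h.symm).trans ?_
  gcongr
  have hq0 : 0 ≤ (1 / ENNReal.ofReal p).toReal := ENNReal.toReal_nonneg
  have hq1 : (1 / ENNReal.ofReal p).toReal ≤ 1 := by
    rw [one_div, ENNReal.toReal_inv, ENNReal.toReal_ofReal (by linarith)]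
    exact inv_le_one_of_one_le₀ hp
  calc ENNReal.ofReal |(s ^ 2)⁻¹| ^ (1 / ENNReal.ofReal p).toReal
      ≤ 4 ^ (1 / ENNReal.ofReal p).toReal := ENNReal.rpow_le_rpow hc hq0
    _ ≤ 4 ^ (1 : ℝ) := ENNReal.rpow_le_rpow_of_exponent_le (by norm_num) hq1
    _ = 4 := ENNReal.rpow_one _

lemma eLpNorm_discMeasure_le {p : ENNReal} {C : ℝ} (h : ∀ z ∈ ball (0 : ℂ) 1, ‖f z‖ ≤ C) :
    eLpNorm f p discMeasure ≤ ENNReal.ofReal C := by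
  have h1 : ∀ᵐ z ∂discMeasure, ‖f z‖ ≤ C := by
    rw [ae_discMeasure_iff]
    filter_upwards [ae_restrict_mem isOpen_ball.measurableSet] with z hz using h z hz
  simpa using eLpNorm_le_of_ae_bound (p := p) h1

lemma exists_differentiableOn_ball_approx (hp : 1 ≤ p) (hf : MemAp p f) {ε : ℝ} (hε : 0 < ε) :
    ∃ (h : ℂ → ℂ) (R : ℝ), 1 < R ∧ DifferentiableOn ℂ h (ball 0 R) ∧
      eLpNorm (fun z => h z - f z) (ENNReal.ofReal p) discMeasure ≤ ENNReal.ofReal ε := by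
  have hp0 : 0 < p := by linarith
  set P := ENNReal.ofReal p with hP
  have hP1 : 1 ≤ P := by simpa [hP] using hp
  set F : ℂ → ℂ := (ball (0 : ℂ) 1).indicator f with hF
  have hFL : MemLp F P volume := by
    rw [hF, memLp_indicator_iff_restrict isOpen_ball.measurableSet,
      ← integrable_norm_rpow_iff (hf.1.continuousOn.aestronglyMeasurable isOpen_ball.measurableSet)
      (by simpa [hP] using hp0) ENNReal.ofReal_ne_top, ENNReal.toReal_ofReal hp0.le]
    exact hf.2
  set η := ε / 6 with hη
  have hη0 : 0 < η := by positivity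
  obtain ⟨φ, hφc, hφF, hφ, hφL⟩ := hFL.exists_hasCompactSupport_eLpNorm_sub_le
    ENNReal.ofReal_ne_top (ε := ENNReal.ofReal η) (by simpa using hη0)
  obtain ⟨δ, hδ, hδφ⟩ := Metric.uniformContinuous_iff.1
    (hφc.uniformContinuous_of_continuous hφ) η hη0
  obtain ⟨s, hs1, hs⟩ := exists_between (max_lt (by norm_num : (1 / 2 : ℝ) < 1)
    (by linarith : 1 - δ < 1))
  have hs2 : 1 / 2 ≤ s := (le_max_left _ _).trans hs1.le
  have hs0 : 0 < s := by linarith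
  have hsδ : 1 - s < δ := by linarith [(le_max_right (1 / 2 : ℝ) (1 - δ)).trans_lt hs1]
  refine ⟨fun z => f (s • z), s⁻¹, (one_lt_inv₀ hs0).2 hs, ?_, ?_⟩
  · refine hf.1.comp (by fun_prop) fun z hz => ?_
    rw [mem_ball_zero_iff] at hz ⊢
    rw [norm_smul, Real.norm_of_nonneg hs0.le]
    calc s * ‖z‖ < s * s⁻¹ := by gcongr
      _ = 1 := mul_inv_cancel₀ hs0.ne'
  · have hmem : ∀ z ∈ ball (0 : ℂ) 1, s • z ∈ ball (0 : ℂ) 1 := fun z hz => by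
      rw [mem_ball_zero_iff] at hz ⊢
      rw [norm_smul, Real.norm_of_nonneg hs0.le]
      nlinarith [norm_nonneg z]
    have hFφ : AEStronglyMeasurable (F - φ) volume := (hFL.sub hφL).1
    have h1 : eLpNorm (fun z => (F - φ) (s • z)) P discMeasure ≤ ENNReal.ofReal (4 * η) := by
      refine (eLpNorm_mono_measure _ discMeasure_le_volume).trans
        ((eLpNorm_comp_smul_le hp hFφ hs2).trans ?_)
      rw [ENNReal.ofReal_mul (by norm_num), show ENNReal.ofReal 4 = 4 by norm_num]
      gcongr
    have h2 : eLpNorm (fun z => φ (s • z) - φ z) P discMeasure ≤ ENNReal.ofReal η := by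
      refine eLpNorm_discMeasure_le fun z hz => ?_
      rw [← dist_eq_norm]
      refine (hδφ ?_).le
      rw [dist_eq_norm, show s • z - z = (s - 1) • z by rw [sub_smul, one_smul], norm_smul,
        Real.norm_of_nonpos (by linarith)]
      rw [mem_ball_zero_iff] at hz
      nlinarith
    have h3 : eLpNorm (φ - F) P discMeasure ≤ ENNReal.ofReal η := by
      rw [eLpNorm_sub_comm]
      exact (eLpNorm_mono_measure _ discMeasure_le_volume).trans hφF
    have m3 : AEStronglyMeasurable (φ - F) discMeasure :=
      (hφL.sub hFL).1.mono_measure discMeasure_le_volume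
    have m2 : AEStronglyMeasurable (fun z => φ (s • z) - φ z) discMeasure :=
      Continuous.aestronglyMeasurable (by fun_prop)
    have m1 : AEStronglyMeasurable (fun z => (F - φ) (s • z)) discMeasure := by
      have : AEStronglyMeasurable (fun z => (F - φ) (s • z)) volume := by
        refine hFφ.comp_quasiMeasurePreserving ⟨by fun_prop, ?_⟩
        rw [Measure.map_addHaar_smul _ hs0.ne']
        exact Measure.smul_absolutelyContinuous
      exact this.mono_measure discMeasure_le_volume
    have hae : (fun z => f (s • z) - f z) =ᵐ[discMeasure]
        ((fun z => (F - φ) (s • z)) + fun z => φ (s • z) - φ z) + (φ - F) := by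
      rw [Filter.EventuallyEq, ae_discMeasure_iff]
      filter_upwards [ae_restrict_mem isOpen_ball.measurableSet] with z hz
      simp only [Pi.add_apply, Pi.sub_apply, hF, indicator_of_mem hz, indicator_of_mem (hmem z hz)]
      ring
    rw [eLpNorm_congr_ae hae]
    calc _ ≤ _ := eLpNorm_add_le (m1.add m2) m3 hP1
      _ ≤ _ := add_le_add_left (eLpNorm_add_le m1 m2 hP1) _
      _ ≤ ENNReal.ofReal (4 * η) + ENNReal.ofReal η + ENNReal.ofReal η := by gcongr
      _ = ENNReal.ofReal ε := by
        rw [← ENNReal.ofReal_add (by positivity) hη0.le,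
          ← ENNReal.ofReal_add (by positivity) hη0.le, hη]
        ring_nf

lemma memLp_one_sub_norm_rpow (hp : 0 < p) :
    MemLp (fun z : ℂ => (1 - ‖z‖) ^ (-(1 / (2 * p)))) (ENNReal.ofReal p) discMeasure := by
  have hm : Measurable fun z : ℂ => (1 - ‖z‖) ^ (-(1 / (2 * p))) := by fun_prop
  rw [← integrable_norm_rpow_iff hm.aestronglyMeasurable (by simpa using hp)
    ENNReal.ofReal_ne_top, ENNReal.toReal_ofReal hp.le, ← integrableOn_ball_iff]
  have h : IntegrableOn (fun z : ℂ => (1 - ‖z‖) ^ (-(1 / 2 : ℝ))) (ball 0 1) := by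
    rw [integrableOn_fun_norm_addHaar volume (f := fun y : ℝ => (1 - y) ^ (-(1 / 2 : ℝ))),
      Complex.finrank_real_complex]
    have h1 : IntervalIntegrable (fun x : ℝ => x ^ (-(1 / 2 : ℝ))) volume 0 1 :=
      intervalIntegral.intervalIntegrable_rpow' (by norm_num)
    have h2 := (h1.comp_sub_left 1).mul_continuousOn (g := fun y : ℝ => y ^ (2 - 1))
      (by fun_prop)
    rw [sub_zero, sub_self] at h2
    have h3 := (intervalIntegrable_iff_integrableOn_Ioo_of_le zero_le_one).1 h2.symm
    refine h3.congr_fun (fun y _ => ?_) measurableSet_Ioo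
    simp only [smul_eq_mul]
    ring
  refine h.congr_fun (fun z hz => ?_) isOpen_ball.measurableSet
  have hz1 : 0 ≤ 1 - ‖z‖ := by
    rw [mem_ball_zero_iff] at hz
    linarith
  simp only
  rw [Real.norm_of_nonneg (by positivity), ← Real.rpow_mul hz1]
  congr 1
  field_simp

lemma exists_bergman_approx {K : Set ℂ} (hKc : IsCompact K)
    (hKT : K ⊆ sphere (0 : ℂ) 1) (hK : BergmanAdmissible K) (hp : 1 ≤ p) (φ : C(K, ℂ))
    (l : ℕ) (hf : MemAp p f) {ε : ℝ} (hε : 0 < ε) {δ : ENNReal} (hδ : 0 < δ) :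
    ∃ (g : ℂ → ℂ) (S : ℝ), 1 < S ∧ DifferentiableOn ℂ g (ball 0 S) ∧
      eLpNorm (fun z => g z - f z) (ENNReal.ofReal p) discMeasure < δ ∧
      ∀ ζ : K, ‖iteratedDeriv l g ζ - φ ζ‖ ≤ ε := by
  have hp0 : 0 < p := by linarith
  obtain ⟨d, hd0, hdδ⟩ := ENNReal.lt_iff_exists_nnreal_btwn.1 hδ
  have hd : (0 : ℝ) < d := by exact_mod_cast hd0
  obtain ⟨h, R, hR, hh, hhf⟩ := exists_differentiableOn_ball_approx hp hf (half_pos hd)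
  have hw := memLp_one_sub_norm_rpow hp0
  set C := eLpNorm (fun z : ℂ => (1 - ‖z‖) ^ (-(1 / (2 * p)))) (ENNReal.ofReal p) discMeasure
    with hC
  have hCt : C ≠ ⊤ := hw.2.ne
  set η := min ε (d / 2 / (C.toReal + 1)) with hη
  have hη0 : 0 < η := lt_min hε (by positivity)
  obtain ⟨g, S, hS, hg, hgh, hgφ⟩ := exists_approx_iteratedDeriv hKc hKT hK
    (a := 1 / (2 * p)) (by positivity) φ hη0 l hR hh
  refine ⟨g, S, hS, hg, ?_, fun ζ => (hgφ ζ).trans (min_le_left _ _)⟩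
  have h1 : eLpNorm (fun z => g z - h z) (ENNReal.ofReal p) discMeasure ≤
      ENNReal.ofReal (d / 2) := by
    have hae : ∀ᵐ z ∂discMeasure,
        ‖g z - h z‖ ≤ η * ‖(1 - ‖z‖) ^ (-(1 / (2 * p)))‖ := by
      rw [ae_discMeasure_iff]
      filter_upwards [ae_restrict_mem isOpen_ball.measurableSet] with z hz
      exact (hgh z hz).trans (mul_le_mul_of_nonneg_left (Real.le_norm_self _) hη0.le)
    refine (eLpNorm_le_mul_eLpNorm_of_ae_le_mul hae _).trans ?_
    rw [← hC, ← ENNReal.ofReal_toReal hCt, ← ENNReal.ofReal_mul hη0.le]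
    refine ENNReal.ofReal_le_ofReal ?_
    calc η * C.toReal ≤ d / 2 / (C.toReal + 1) * (C.toReal + 1) := by
          gcongr
          · exact min_le_right _ _
          · linarith
      _ = d / 2 := div_mul_cancel₀ _ (by positivity)
  have m1 := aestronglyMeasurable_discMeasure
    ((hg.mono (ball_subset_ball hS.le)).sub (hh.mono (ball_subset_ball hR.le)))
  have m2 := aestronglyMeasurable_discMeasure ((hh.mono (ball_subset_ball hR.le)).sub hf.1)
  have h2 := eLpNorm_add_le m1 m2 (p := ENNReal.ofReal p) (by simpa using hp)
  have he : (g - h) + (h - f) = fun z => g z - f z := by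
    ext z
    simp
  rw [he] at h2
  refine (h2.trans (add_le_add h1 hhf)).trans_lt ?_
  rw [← ENNReal.ofReal_add (by positivity) (by positivity), add_halves, ENNReal.ofReal_coe_nnreal]
  exact hdδ

lemma norm_iteratedDeriv_le_eLpNorm (hp : 1 ≤ p) (hf : MemAp p f) (l : ℕ) {δ : ℝ} (hδ : 0 < δ)
    {w : ℂ} (hw : ‖w‖ + 2 * δ ≤ 1) :
    ‖iteratedDeriv l f w‖ ≤ l.factorial * ((δ ^ 2)⁻¹ *
      (eLpNorm f (ENNReal.ofReal p) discMeasure).toReal) / δ ^ l := by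
  have hp0 : 0 < p := by linarith
  have hfin := ((memAp_iff hp0).1 hf).2.2.ne
  refine Complex.norm_iteratedDeriv_le_of_forall_mem_sphere_norm_le l hδ ?_ fun z hz => ?_
  · refine DifferentiableOn.diffContOnCl (hf.1.mono ?_)
    rw [closure_ball _ hδ.ne']
    exact closedBall_subset_ball' (by rw [dist_zero_right]; linarith)
  · have hz1 : ‖z‖ ≤ ‖w‖ + δ := by
      have h1 : ‖z - w‖ = δ := by simpa using hz
      have h2 := norm_add_le w (z - w)
      rw [add_sub_cancel, h1] at h2
      exact h2
    have h := enorm_le_eLpNorm hp hf.1 hδ (w := z) (by linarith)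
    rw [← ENNReal.ofReal_toReal hfin, ← ENNReal.ofReal_mul (by positivity), ← ofReal_norm,
      ENNReal.ofReal_le_ofReal_iff (by positivity)] at h
    exact h

end BergmanApprox

section RadialLimits

variable {p : ℝ} {ρ : Set ℝ} {K : Set ℂ}

/-- Functions whose `l`-th derivative is `ε`-close to `φ` along some dilation parameter in `ρ`
larger than `R`, uniformly with respect to centres in the closed disc of radius `s`. -/
def dilationApprox (p : ℝ) (ρ : Set ℝ) (φ : C(K, ℂ)) (l : ℕ) (s ε R : ℝ) : Set (ApSpace p) :=
  {f | ∃ r ∈ ρ, R < r ∧ ∃ η < ε, ∀ ζ : K, ∀ z ∈ closedBall (0 : ℂ) s,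
    ‖iteratedDeriv l f.1 ((r : ℂ) * (ζ - z) + z) - φ ζ‖ ≤ η}

lemma norm_dilation_le {ζ z : ℂ} {r s : ℝ} (hr : r ∈ Ico (0 : ℝ) 1) (hζ : ‖ζ‖ = 1)
    (hz : ‖z‖ ≤ s) : ‖(r : ℂ) * (ζ - z) + z‖ ≤ 1 - (1 - r) * (1 - s) := by
  have h : (r : ℂ) * (ζ - z) + z = (r : ℂ) * ζ + ((1 - r : ℝ) : ℂ) * z := by
    push_cast
    ring
  rw [h]
  refine (norm_add_le _ _).trans ?_
  rw [norm_mul, norm_mul, Complex.norm_real, Complex.norm_real, hζ,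
    Real.norm_of_nonneg hr.1, Real.norm_of_nonneg (by linarith [hr.2])]
  nlinarith [mul_le_mul_of_nonneg_left hz (by linarith [hr.2] : 0 ≤ 1 - r)]

lemma iteratedDeriv_sub_of_differentiableOn {f g : ℂ → ℂ} {U : Set ℂ} (hU : IsOpen U)
    (hf : DifferentiableOn ℂ f U) (hg : DifferentiableOn ℂ g U) (l : ℕ) {w : ℂ} (hw : w ∈ U) :
    iteratedDeriv l (fun z => f z - g z) w = iteratedDeriv l f w - iteratedDeriv l g w :=
  iteratedDeriv_fun_sub ((hf.contDiffOn hU).contDiffAt (hU.mem_nhds hw))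
    ((hg.contDiffOn hU).contDiffAt (hU.mem_nhds hw))

lemma continuousOn_iteratedDeriv_of_differentiableOn {f : ℂ → ℂ} {U : Set ℂ} (hU : IsOpen U)
    (hf : DifferentiableOn ℂ f U) (l : ℕ) : ContinuousOn (iteratedDeriv l f) U := by
  suffices h : DifferentiableOn ℂ (iteratedDeriv l f) U from h.continuousOn
  induction l with
  | zero => simpa using hf
  | succ l ih =>
    rw [iteratedDeriv_succ]
    exact ih.deriv hU

lemma isOpen_dilationApprox (hp : 1 ≤ p) (hρ : ρ ⊆ Ico (0 : ℝ) 1)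
    (hKT : K ⊆ sphere (0 : ℂ) 1) (φ : C(K, ℂ)) (l : ℕ) {s : ℝ} (hs : s < 1) (ε R : ℝ) :
    IsOpen (dilationApprox p ρ φ l s ε R) := by
  have hp0 : 0 < p := by linarith
  rw [isOpen_apSpace_iff hp]
  rintro f ⟨r, hr, hRr, η, hη, hf⟩
  set δ := (1 - r) * (1 - s) / 2 with hδ
  have hδ0 : 0 < δ := by
    have := (hρ hr).2
    have h1 : 0 < 1 - r := by linarith
    have h2 : 0 < 1 - s := by linarith
    positivity
  set C := (l.factorial : ℝ) * (δ ^ 2)⁻¹ / δ ^ l with hC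
  have hC0 : 0 < C := by positivity
  set γ := (ε - η) / 2 / C with hγ
  have hγ0 : 0 < γ := by
    have : 0 < ε - η := by linarith
    positivity
  refine ⟨ENNReal.ofReal γ, by simpa using hγ0, fun g hg => ?_⟩
  refine ⟨r, hr, hRr, η + (ε - η) / 2, by linarith, fun ζ z hz => ?_⟩
  set w : ℂ := (r : ℂ) * (ζ - z) + z with hw
  have hw1 : ‖w‖ + 2 * δ ≤ 1 := by
    have := norm_dilation_le (hρ hr) (mem_sphere_zero_iff_norm.1 (hKT ζ.2))
      (mem_closedBall_zero_iff.1 hz)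
    rw [← hw] at this
    rw [hδ]
    linarith
  have hwb : w ∈ ball (0 : ℂ) 1 := by
    rw [mem_ball_zero_iff]
    linarith
  have h1 := norm_iteratedDeriv_le_eLpNorm hp (g.2.sub hp0 f.2) l hδ0 hw1
  rw [iteratedDeriv_sub_of_differentiableOn isOpen_ball g.2.1 f.2.1 l hwb] at h1
  have h2 : (eLpNorm (fun z => g.1 z - f.1 z) (ENNReal.ofReal p) discMeasure).toReal ≤ γ :=
    ENNReal.toReal_le_of_le_ofReal hγ0.le hg.le
  have h3 : ‖iteratedDeriv l g.1 w - iteratedDeriv l f.1 w‖ ≤ (ε - η) / 2 := by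
    refine h1.trans ?_
    calc _ = C * (eLpNorm (fun z => g.1 z - f.1 z) (ENNReal.ofReal p) discMeasure).toReal := by
          rw [hC]
          ring
      _ ≤ C * γ := by gcongr
      _ = (ε - η) / 2 := mul_div_cancel₀ _ hC0.ne'
  calc _ = ‖(iteratedDeriv l f.1 w - φ ζ) + (iteratedDeriv l g.1 w - iteratedDeriv l f.1 w)‖ := by
        ring_nf
    _ ≤ _ := (norm_add_le _ _).trans (add_le_add (hf ζ z hz) h3)

lemma exists_mem_gt_of_accPt (hρ1 : AccPt (1 : ℝ) (𝓟 ρ)) {R : ℝ}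
    (hR : R < 1) : ∃ r ∈ ρ, R < r := by
  obtain ⟨r, hr, -⟩ := accPt_iff_nhds.1 hρ1 (Ioi R) (Ioi_mem_nhds hR)
  exact ⟨r, hr.2, hr.1⟩

lemma dense_dilationApprox (hp : 1 ≤ p) (hρ : ρ ⊆ Ico (0 : ℝ) 1) (hρ1 : AccPt (1 : ℝ) (𝓟 ρ))
    (hKc : IsCompact K) (hKT : K ⊆ sphere (0 : ℂ) 1) (hK : BergmanAdmissible K) (φ : C(K, ℂ))
    (l : ℕ) {s ε R : ℝ} (hs : s < 1) (hε : 0 < ε) (hR : R < 1) :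
    Dense (dilationApprox p ρ φ l s ε R) := by
  have hp0 : 0 < p := by linarith
  rw [dense_iff_inter_open]
  rintro U hU ⟨f, hf⟩
  obtain ⟨δ, hδ, hδU⟩ := (isOpen_apSpace_iff hp).1 hU f hf
  obtain ⟨g, S, hS, hg, hgf, hgφ⟩ := exists_bergman_approx hKc hKT hK hp φ l f.2
    (by positivity : 0 < ε / 4) hδ
  refine ⟨⟨g, memAp_of_differentiableOn_ball hp0 hS hg⟩, hδU _ hgf, ?_⟩
  have huc := (isCompact_closedBall (0 : ℂ) 1).uniformContinuousOn_of_continuous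
    ((continuousOn_iteratedDeriv_of_differentiableOn isOpen_ball hg l).mono
      (closedBall_subset_ball hS))
  obtain ⟨d, hd, hdg⟩ := Metric.uniformContinuousOn_iff.1 huc (ε / 4) (by positivity)
  obtain ⟨r, hr, hRr⟩ := exists_mem_gt_of_accPt hρ1 (max_lt hR (by linarith : 1 - d / 2 < 1))
  have hr1 := (hρ hr).2
  refine ⟨r, hr, (le_max_left _ _).trans_lt hRr, ε / 2, by linarith, fun ζ z hz => ?_⟩
  have hζ := mem_sphere_zero_iff_norm.1 (hKT ζ.2)
  rw [mem_closedBall_zero_iff] at hz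
  have hw := norm_dilation_le (hρ hr) hζ hz
  set w : ℂ := (r : ℂ) * (ζ - z) + z with hwdef
  have hdist : dist w ζ < d := by
    rw [dist_eq_norm, show w - ζ = ((1 - r : ℝ) : ℂ) * (z - ζ) by
      rw [hwdef]
      push_cast
      ring, norm_mul, Complex.norm_real, Real.norm_of_nonneg (by linarith)]
    have h1 : ‖z - ζ‖ ≤ 2 := (norm_sub_le _ _).trans (by linarith)
    have h2 := (le_max_right R (1 - d / 2)).trans_lt hRr
    nlinarith [mul_le_mul_of_nonneg_left h1 (by linarith : 0 ≤ 1 - r)]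
  have hwc : w ∈ closedBall (0 : ℂ) 1 := by
    rw [mem_closedBall_zero_iff]
    nlinarith
  have h1 := hdg w hwc ζ (by simp [hζ]) hdist
  rw [dist_eq_norm] at h1
  calc _ = ‖(iteratedDeriv l g w - iteratedDeriv l g ζ) + (iteratedDeriv l g ζ - φ ζ)‖ := by
        ring_nf
    _ ≤ ε / 4 + ε / 4 := (norm_add_le _ _).trans (add_le_add h1.le (hgφ ζ))
    _ = ε / 2 := by ring

lemma le_biSup₂_of_bounded {F : ℂ → ℂ → ℝ} {A B : Set ℂ} {M : ℝ} (hM : 0 ≤ M)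
    (hF : ∀ ζ ∈ A, ∀ z ∈ B, F ζ z ≤ M) {ζ z : ℂ} (hζ : ζ ∈ A) (hz : z ∈ B) :
    F ζ z ≤ ⨆ ζ ∈ A, ⨆ z ∈ B, F ζ z := by
  have h1 : ∀ ζ ∈ A, ∀ z, ⨆ (_ : z ∈ B), F ζ z ≤ M := fun ζ hζ z =>
    Real.iSup_le (fun hz => hF ζ hζ z hz) hM
  have h2 : ∀ ζ, ⨆ (_ : ζ ∈ A), ⨆ z ∈ B, F ζ z ≤ M := fun ζ =>
    Real.iSup_le (fun hζ => Real.iSup_le (h1 ζ hζ) hM) hM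
  calc F ζ z = ⨆ (_ : z ∈ B), F ζ z := (ciSup_pos (f := fun _ => F ζ z) hz).symm
    _ ≤ ⨆ z ∈ B, F ζ z := le_ciSup (f := fun z => ⨆ (_ : z ∈ B), F ζ z)
        ⟨M, by rintro _ ⟨z, rfl⟩; exact h1 ζ hζ z⟩ z
    _ = ⨆ (_ : ζ ∈ A), ⨆ z ∈ B, F ζ z := (ciSup_pos (f := fun _ => ⨆ z ∈ B, F ζ z) hζ).symm
    _ ≤ _ := le_ciSup (f := fun ζ => ⨆ (_ : ζ ∈ A), ⨆ z ∈ B, F ζ z)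
        ⟨M, by rintro _ ⟨ζ, rfl⟩; exact h2 ζ⟩ ζ

lemma mem_dilationApprox_of_mem_DVAp (hρ : ρ ⊆ Ico (0 : ℝ) 1)
    (hKc : IsCompact K) (hKT : K ⊆ sphere (0 : ℂ) 1) {f : ApSpace p} (hf : f ∈ DVAp p ρ K)
    (φ : C(K, ℂ)) (l : ℕ) {s ε R : ℝ} (hs : s < 1) (hε : 0 < ε) (hR : R < 1) :
    f ∈ dilationApprox p ρ φ l s ε R := by
  have : CompactSpace K := isCompact_iff_compactSpace.1 hKc
  have hφ' : ∀ ζ : K, Function.extend Subtype.val φ 0 (ζ : ℂ) = φ ζ := fun ζ =>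
    Subtype.val_injective.extend_apply _ _ ζ
  have hφc : ContinuousOn (Function.extend Subtype.val φ 0) K := by
    rw [continuousOn_iff_continuous_domRestrict]
    convert φ.continuous using 1
    ext ζ
    exact hφ' ζ
  obtain ⟨r, hrρ, -, hr1, hr⟩ := hf _ hφc (closedBall 0 s) (isCompact_closedBall _ _)
    (closedBall_subset_ball hs) l
  obtain ⟨n, hn1, hn2⟩ := ((hr1.eventually (lt_mem_nhds hR)).and
    (hr.eventually (gt_mem_nhds (half_pos hε)))).exists
  have hrn := hρ (hrρ n)
  refine ⟨r n, hrρ n, hn1, ε / 2, by linarith, fun ζ z hz => ?_⟩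
  set t := 1 - (1 - r n) * (1 - s) with ht
  have ht1 : t < 1 := by
    have := mul_pos (by linarith [hrn.2] : 0 < 1 - r n) (by linarith : 0 < 1 - s)
    linarith
  obtain ⟨C, hC⟩ := (isCompact_closedBall (0 : ℂ) t).exists_bound_of_continuousOn
    ((continuousOn_iteratedDeriv_of_differentiableOn isOpen_ball f.2.1 l).mono
      (closedBall_subset_ball ht1))
  have hbound : ∀ ξ ∈ K, ∀ z ∈ closedBall (0 : ℂ) s,
      ‖iteratedDeriv l f.1 (((r n : ℝ) : ℂ) * (ξ - z) + z) -
        Function.extend Subtype.val φ 0 ξ‖ ≤ |C| + ‖φ‖ := by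
    intro ξ hξ z hz
    refine (norm_sub_le _ _).trans (add_le_add ((hC _ ?_).trans (le_abs_self C)) ?_)
    · rw [mem_closedBall_zero_iff]
      exact norm_dilation_le hrn (mem_sphere_zero_iff_norm.1 (hKT hξ))
        (mem_closedBall_zero_iff.1 hz)
    · rw [hφ' ⟨ξ, hξ⟩]
      exact φ.norm_coe_le_norm _
  have h := le_biSup₂_of_bounded (by positivity) hbound ζ.2 hz
  rw [hφ' ζ] at h
  exact h.trans hn2.le

lemma exists_strictMono_seq {Q : ℕ → ℝ → Prop}
    (h : ∀ n : ℕ, ∀ R < (1 : ℝ), ∃ r, R < r ∧ r < 1 ∧ Q n r) :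
    ∃ r : ℕ → ℝ, StrictMono r ∧ Tendsto r atTop (𝓝 1) ∧ ∀ n, Q n (r n) := by
  choose! u hu hu1 huQ using h
  let v : ℕ → ℝ := fun n => Nat.rec 0 (fun n x => u n (max x (1 - 1 / ((n : ℝ) + 1)))) n
  have hv : ∀ n, v (n + 1) = u n (max (v n) (1 - 1 / ((n : ℝ) + 1))) := fun _ => rfl
  have hpos : ∀ n : ℕ, (1 : ℝ) - 1 / ((n : ℝ) + 1) < 1 := fun n => by
    have : (0 : ℝ) < 1 / ((n : ℝ) + 1) := by positivity
    linarith
  have hv1 : ∀ n, v n < 1 := by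
    intro n
    induction n with
    | zero => exact zero_lt_one
    | succ n ih => exact hv n ▸ hu1 n _ (max_lt ih (hpos n))
  have hvR : ∀ n, max (v n) (1 - 1 / ((n : ℝ) + 1)) < v (n + 1) := fun n =>
    hv n ▸ hu n _ (max_lt (hv1 n) (hpos n))
  refine ⟨fun n => v (n + 1), strictMono_nat_of_lt_succ fun n =>
    (le_max_left _ _).trans_lt (hvR (n + 1)), ?_, fun n => huQ n _ (max_lt (hv1 n) (hpos n))⟩
  refine tendsto_of_tendsto_of_tendsto_of_le_of_le (g := fun n : ℕ => 1 - 1 / ((n : ℝ) + 1)) ?_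
    tendsto_const_nhds (fun n => ((le_max_right _ _).trans_lt (hvR n)).le) fun n => (hv1 (n + 1)).le
  simpa using (tendsto_const_nhds (x := (1 : ℝ))).sub tendsto_one_div_add_atTop_nhds_zero_nat

lemma mem_DVAp_of_forall_mem_dilationApprox (hρ : ρ ⊆ Ico (0 : ℝ) 1)
    (hKc : IsCompact K) {D : Set C(K, ℂ)} (hD : Dense D)
    {f : ApSpace p}
    (hf : ∀ φ ∈ D, ∀ l i k j : ℕ, f ∈ dilationApprox p ρ φ l (1 - 1 / ((i : ℝ) + 1))
      (1 / ((k : ℝ) + 1)) (1 - 1 / ((j : ℝ) + 1))) : f ∈ DVAp p ρ K := by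
  have : CompactSpace K := isCompact_iff_compactSpace.1 hKc
  intro φ hφ L hL hLb l
  let φK : C(K, ℂ) := ⟨K.domRestrict φ, hφ.domRestrict⟩
  obtain ⟨t, ht, hLt⟩ := exists_lt_subset_ball hL.isClosed hLb
  obtain ⟨i, hi⟩ := exists_nat_one_div_lt (sub_pos.2 ht)
  have hLi : L ⊆ closedBall 0 (1 - 1 / ((i : ℝ) + 1)) :=
    hLt.trans (ball_subset_closedBall.trans (closedBall_subset_closedBall (by linarith)))
  obtain ⟨r, hrm, hr1, hr⟩ := exists_strictMono_seq (Q := fun n r => r ∈ ρ ∧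
      ∀ ζ ∈ K, ∀ z ∈ L, ‖iteratedDeriv l f.1 ((r : ℂ) * (ζ - z) + z) - φ ζ‖ ≤
        1 / ((n : ℝ) + 1)) fun n R hR => by
    have hε : (0 : ℝ) < 1 / ((n : ℝ) + 1) / 2 := by positivity
    obtain ⟨ψ, hψ, hψD⟩ := Metric.dense_iff.1 hD φK _ hε
    obtain ⟨k, hk⟩ := exists_nat_one_div_lt hε
    obtain ⟨j, hj⟩ := exists_nat_one_div_lt (sub_pos.2 hR)
    obtain ⟨r, hr, hjr, η, hη, hfr⟩ := hf ψ hψD l i k j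
    refine ⟨r, by linarith, (hρ hr).2, hr, fun ζ hζ z hz => ?_⟩
    have h1 := hfr ⟨ζ, hζ⟩ z (hLi hz)
    have h2 : ‖ψ ⟨ζ, hζ⟩ - φ ζ‖ ≤ 1 / ((n : ℝ) + 1) / 2 := by
      have := (ContinuousMap.dist_apply_le_dist (f := ψ) (g := φK) ⟨ζ, hζ⟩).trans
        (mem_ball.1 hψ).le
      rwa [dist_eq_norm] at this
    calc _ = ‖(iteratedDeriv l f.1 ((r : ℂ) * (ζ - z) + z) - ψ ⟨ζ, hζ⟩) +
          (ψ ⟨ζ, hζ⟩ - φ ζ)‖ := by ring_nf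
      _ ≤ 1 / ((n : ℝ) + 1) / 2 + 1 / ((n : ℝ) + 1) / 2 :=
        (norm_add_le _ _).trans (add_le_add (h1.trans (hη.le.trans hk.le)) h2)
      _ = _ := add_halves _
  refine ⟨r, fun n => (hr n).1, hrm, hr1, ?_⟩
  refine squeeze_zero (fun n => ?_) (fun n => ?_) tendsto_one_div_add_atTop_nhds_zero_nat
  · exact Real.iSup_nonneg fun ζ => Real.iSup_nonneg fun _ => Real.iSup_nonneg fun z =>
      Real.iSup_nonneg fun _ => norm_nonneg _
  · have h0 : (0 : ℝ) ≤ 1 / ((n : ℝ) + 1) := by positivity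
    exact Real.iSup_le (fun ζ => Real.iSup_le (fun hζ => Real.iSup_le (fun z =>
      Real.iSup_le (fun hz => (hr n).2 ζ hζ z hz) h0) h0) h0) h0

end RadialLimits

/-- Theorem (bergdermain): for `2 < p < ∞`, `ρ ⊆ [0,1)` with `1` as a limit point, and
admissible compact `K ⊆ 𝕋`, `𝒟𝒱_{A^p}^K(𝔻,ρ)` is a dense `G_δ` subset of `A^p(𝔻)`. -/
theorem statement_15 (p : ℝ) (hp : 2 < p)
    (ρ : Set ℝ) (hρ : ρ ⊆ Set.Ico (0:ℝ) 1) (hρ1 : AccPt (1:ℝ) (Filter.principal ρ))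
    (K : Set ℂ) (hKc : IsCompact K) (hKT : K ⊆ Metric.sphere (0:ℂ) 1)
    (hK : BergmanAdmissible K) :
    IsGδ (DVAp p ρ K) ∧ Dense (DVAp p ρ K) := by
  have hp1 : 1 ≤ p := by linarith
  have : CompactSpace K := isCompact_iff_compactSpace.1 hKc
  have := baireSpace_apSpace hp1
  obtain ⟨D, hDc, hD⟩ := TopologicalSpace.exists_countable_dense C(K, ℂ)
  have hpos : ∀ n : ℕ, (0 : ℝ) < 1 / ((n : ℝ) + 1) := fun n => by positivity
  have hlt : ∀ n : ℕ, (1 : ℝ) - 1 / ((n : ℝ) + 1) < 1 := fun n => by linarith [hpos n]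
  have hcount : Countable D := hDc.to_subtype
  have hDV : DVAp p ρ K = ⋂ x : D × ℕ × ℕ × ℕ × ℕ,
      dilationApprox p ρ x.1.1 x.2.1 (1 - 1 / ((x.2.2.1 : ℝ) + 1))
        (1 / ((x.2.2.2.1 : ℝ) + 1)) (1 - 1 / ((x.2.2.2.2 : ℝ) + 1)) := by
    ext f
    rw [mem_iInter]
    refine ⟨fun hf x => mem_dilationApprox_of_mem_DVAp hρ hKc hKT hf _ _ (hlt _) (hpos _) (hlt _),
      fun hf => mem_DVAp_of_forall_mem_dilationApprox hρ hKc hD fun φ hφ l i k j =>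
        hf (⟨φ, hφ⟩, l, i, k, j)⟩
  rw [hDV]
  exact ⟨IsGδ.iInter_of_isOpen fun x => isOpen_dilationApprox hp1 hρ hKT _ _ (hlt _) _ _,
    dense_iInter_of_isOpen (fun x => isOpen_dilationApprox hp1 hρ hKT _ _ (hlt _) _ _)
      fun x => dense_dilationApprox hp1 hρ hρ1 hKc hKT hK _ _ (hlt _) (hpos _) (hlt _)⟩
end
end

section
/- Let 1 ≤ p < ∞, let ρ ⊆ [0,1) have 1 as a limit point, and let K ⊆ 𝕋 be a compact set with m(K) > 0. Then no f ∈ H^p(𝔻) has the property that for every continuous function φ on K there exists an increasing sequence (r_n) in ρ converging to 1 with sup_{ζ∈K} |f(r_n ζ) − φ(ζ)| → 0 as n → ∞; that is, the universal radial approximation property fails on every compact subset of 𝕋 of positive arc length measure. -/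
open Complex Metric Set Filter MeasureTheory Polynomial Topology

noncomputable section

/-- On a compact set, a continuous function is pointwise dominated in norm by the iterated real
supremum of its norm. -/
lemma norm_le_biSup_of_isCompact {K : Set ℂ} (hK : IsCompact K) {g : ℂ → ℂ}
    (hg : ContinuousOn g K) {ζ : ℂ} (hζ : ζ ∈ K) : ‖g ζ‖ ≤ ⨆ z ∈ K, ‖g z‖ := by
  obtain ⟨C, hC⟩ := hK.exists_bound_of_continuousOn hg
  have hb : BddAbove (Set.range fun z : ℂ => ⨆ _ : z ∈ K, ‖g z‖) := by
    refine ⟨max C 0, ?_⟩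
    rintro _ ⟨z, rfl⟩
    by_cases hz : z ∈ K
    · simpa [hz] using Or.inl (hC z hz)
    · simp [hz]
  simpa [hζ] using le_ciSup hb ζ

lemma arcMeasure_ne_top (K : Set ℂ) : arcMeasure K ≠ ⊤ :=
  measure_ne_top_of_subset (fun _ h => Set.Ico_subset_Icc_self h.1)
    (isCompact_Icc (a := (0 : ℝ)) (b := 2 * Real.pi)).measure_lt_top.ne

/-- A circular mean of `‖f‖ ^ p` controls `c ^ p` times the arc length of any closed set over which
`‖f‖ ≥ c` on that circle. -/
lemma rpow_mul_arcMeasure_le {p : ℝ} (hp : 1 ≤ p) {f : ℂ → ℂ}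
    (hf : DifferentiableOn ℂ f (Metric.ball (0 : ℂ) 1)) {K : Set ℂ} (hK : IsClosed K)
    {r c : ℝ} (hr0 : 0 ≤ r) (hr1 : r < 1) (hc : 0 ≤ c)
    (hfc : ∀ ζ ∈ K, c ≤ ‖f ((r : ℂ) * ζ)‖) :
    c ^ p * (arcMeasure K).toReal ≤ ∫ θ in (0 : ℝ)..(2 * Real.pi),
      ‖f ((r : ℂ) * Complex.exp ((θ : ℂ) * Complex.I))‖ ^ p := by
  have hcont : Continuous fun θ : ℝ =>
      ‖f ((r : ℂ) * Complex.exp ((θ : ℂ) * Complex.I))‖ ^ p := by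
    refine Continuous.rpow_const (Continuous.norm ?_) fun _ => Or.inr (by linarith)
    refine hf.continuousOn.comp_continuous (by fun_prop) fun θ => ?_
    simpa [Complex.norm_exp_ofReal_mul_I, abs_of_nonneg hr0] using hr1
  set E : Set ℝ := {θ : ℝ | θ ∈ Set.Ico (0 : ℝ) (2 * Real.pi) ∧
    Complex.exp ((θ : ℂ) * Complex.I) ∈ K}
  have hEm : MeasurableSet E :=
    measurableSet_Ico.inter ((hK.preimage (by fun_prop :
      Continuous fun θ : ℝ => Complex.exp ((θ : ℂ) * Complex.I))).measurableSet)
  have hEs : E ⊆ Set.Icc 0 (2 * Real.pi) := fun θ h => Set.Ico_subset_Icc_self h.1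
  have hint := hcont.integrableOn_Icc (μ := volume) (a := 0) (b := 2 * Real.pi)
  have hEfin : volume E ≠ ⊤ := arcMeasure_ne_top K
  rw [intervalIntegral.integral_of_le (by positivity), ← integral_Icc_eq_integral_Ioc]
  calc c ^ p * (arcMeasure K).toReal
      = ∫ _ in E, c ^ p := by
        rw [setIntegral_const, smul_eq_mul, mul_comm]; rfl
    _ ≤ ∫ θ in E, ‖f ((r : ℂ) * Complex.exp ((θ : ℂ) * Complex.I))‖ ^ p :=
        setIntegral_mono_on (integrableOn_const hEfin) (hint.mono_set hEs) hEm fun θ h =>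
          Real.rpow_le_rpow hc (hfc _ h.2) (by linarith)
    _ ≤ _ := setIntegral_mono_set hint (ae_of_all _ fun θ => by positivity) hEs.eventuallyLE

/-- On a compact subset of `𝕋` of positive arc length, no `H^p` function has the universal
radial approximation property. -/
theorem statement_17 (p : ℝ) (hp : 1 ≤ p)
    (ρ : Set ℝ) (hρ : ρ ⊆ Set.Ico (0:ℝ) 1) (hρ1 : AccPt (1:ℝ) (Filter.principal ρ))
    (K : Set ℂ) (hKc : IsCompact K) (hKT : K ⊆ Metric.sphere (0:ℂ) 1)
    (hKm : arcMeasure K ≠ 0) :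
    ¬ ∃ f : ℂ → ℂ, MemHp p f ∧
      ∀ φ : ℂ → ℂ, ContinuousOn φ K →
        ∃ r : ℕ → ℝ, (∀ n, r n ∈ ρ) ∧ StrictMono r ∧
          Filter.Tendsto r Filter.atTop (nhds 1) ∧
          Filter.Tendsto (fun n => ⨆ ζ ∈ K, ‖f (((r n : ℝ) : ℂ) * ζ) - φ ζ‖)
            Filter.atTop (nhds 0) := by
  rintro ⟨f, ⟨hf, B, hB⟩, huniv⟩
  have hp0 : 0 < p := by linarith
  have hfin : arcMeasure K ≠ ⊤ := arcMeasure_ne_top K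
  set v := (arcMeasure K).toReal
  have hv0 : 0 < v := ENNReal.toReal_pos hKm hfin
  set D := 2 * Real.pi * |B| ^ p with hD
  have hD0 : 0 ≤ D := by positivity
  set c := 1 + D / v with hc
  have hc1 : 1 ≤ c := le_add_of_nonneg_right (by positivity)
  obtain ⟨r, hrρ, -, hr1, hlim⟩ := huniv (fun _ => ((c + 1 : ℝ) : ℂ)) continuousOn_const
  obtain ⟨n, hn, hn0⟩ := ((hlim.eventually (gt_mem_nhds one_pos)).and
    (hr1.eventually (lt_mem_nhds one_pos))).exists
  have hn1 : r n < 1 := (hρ (hrρ n)).2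
  have hcont : ContinuousOn (fun ζ : ℂ => f ((r n : ℂ) * ζ) - ((c + 1 : ℝ) : ℂ)) K := by
    refine (hf.continuousOn.comp (by fun_prop) fun ζ hζ => ?_).sub continuousOn_const
    have h1 : ‖ζ‖ = 1 := by simpa using hKT hζ
    simpa [h1, abs_of_pos hn0] using hn1
  have hlow : ∀ ζ ∈ K, c ≤ ‖f ((r n : ℂ) * ζ)‖ := fun ζ hζ => by
    have h1 := norm_le_biSup_of_isCompact hKc hcont hζ
    have h2 := norm_sub_norm_le ((c + 1 : ℝ) : ℂ) (f ((r n : ℂ) * ζ))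
    rw [norm_sub_rev, Complex.norm_of_nonneg (by linarith)] at h2
    linarith
  have hI := rpow_mul_arcMeasure_le hp hf hKc.isClosed hn0.le hn1 (by linarith) hlow
  have hmean := hB ⟨⟨r n, hn0, hn1⟩, rfl⟩
  set I := ∫ θ in (0 : ℝ)..(2 * Real.pi),
    ‖f ((r n : ℂ) * Complex.exp ((θ : ℂ) * Complex.I))‖ ^ p
  have hI0 : 0 ≤ I := le_trans (by positivity) hI
  have hID : I ≤ D := by
    have h := Real.rpow_le_rpow (by positivity) (hmean.trans (le_abs_self B)) hp0.le
    rw [← Real.rpow_mul (by positivity), one_div_mul_cancel hp0.ne', Real.rpow_one] at h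
    rw [hD]
    calc I = 2 * Real.pi * (1 / (2 * Real.pi) * I) := by field_simp
      _ ≤ _ := by gcongr
  have hcp : c ≤ c ^ p := by simpa using Real.rpow_le_rpow_of_exponent_le hc1 hp
  have hcv : c * v = v + D := by rw [hc]; field_simp
  nlinarith [mul_le_mul_of_nonneg_right hcp hv0.le]
end
end
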